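/- arXiv:2005.08253 — 2 statements merged into one kernel-verified Lean document; each statement's English description precedes it below -/
import Mathlib

section
/- Let K be an algebraically closed field of characteristic 0, let c ≥ 5 be an odd integer, let A_c be the explicit c×(2c+2) matrix of linear forms in x, y, t defined in the context, let S = K[x,y,t], and let M_c = {v ∈ S^{2c+2} : A_c·v = 0} be the graded syzygy module of A_c. Then there exist homogeneous elements v₁, …, v_{c+2} ∈ M_c of degree 1 and a homogeneous element w ∈ M_c of degree (c−1)/2 which generate M_c as an S-module, and such that the module of relations {(f₁,…,f_{c+2},g) ∈ S^{c+3} : f₁v₁ + … + f_{c+2}v_{c+2} + g·w = 0} is a free S-module of rank 1 generated by a single relation with the f_i homogeneous of degree (c+1)/2 and g homogeneous of degree 2. (This is the odd case of Proposition 20: E_c has the minimal free resolution 0 → O(−(c+3)/2) → O(−(c−1)/2) ⊕ O(−1)^{c+2} → E_c → 0.) -/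
open Matrix MvPolynomial

/-- Column index (1-based) of the `x` entry of row `j` of the matrix `A_c`:
`(p₁,p₂,p_j) = (1,4,2j+1)`. -/
def pcol (j : ℕ) : ℕ := if j = 1 then 1 else if j = 2 then 4 else 2 * j + 1

/-- Column index (1-based) of the `y` entry of row `j` of the matrix `A_c`:
`(q₁,q₂,q_j) = (2,5,2j+2)`. -/
def qcol (j : ℕ) : ℕ := pcol j + 1

/-- The entry of the matrix `A_c` in (1-based) row `i` and column `j`, evaluated at
`(x, y, t) = (p 0, p 1, p 2)`. -/
def AcEnt {R : Type*} [CommRing R] (p : Fin 3 → R) (i j : ℕ) : R :=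
  if i ≤ 2 then
    (if j = pcol i then p 0 else 0) + (if j = qcol i then p 1 else 0) +
      (if j = qcol i + 1 then p 2 else 0)
  else
    (if j = 2 * i + 1 then p 0 else 0) + (if j = 2 * i + 2 then p 1 else 0) +
      (if j = pcol (i - 2) then p 2 else 0) + (if j = qcol (i - 1) then p 2 else 0)

/-- The explicit `c × (2c+2)` matrix `A_c` of Example 9, evaluated at
`(x, y, t) = (p 0, p 1, p 2)`. -/
def Ac {R : Type*} [CommRing R] (c : ℕ) (p : Fin 3 → R) :
    Matrix (Fin c) (Fin (2 * c + 2)) R :=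
  fun i j => AcEnt p ((i : ℕ) + 1) ((j : ℕ) + 1)

/-- The matrix `A_c` as a matrix of linear forms over `S = K[x,y,t]`,
with `(x, y, t) = (X 0, X 1, X 2)`. -/
noncomputable def AcPoly (K : Type*) [Field K] (c : ℕ) :
    Matrix (Fin c) (Fin (2 * c + 2)) (MvPolynomial (Fin 3) K) :=
  Ac c (fun k => MvPolynomial.X k)

/-- The graded syzygy module `M_c = {v ∈ S^{2c+2} : A_c·v = 0}` as an `S`-submodule of
`S^{2c+2}`, `S = K[x,y,t]`. -/
noncomputable def syzMod (K : Type*) [Field K] (c : ℕ) :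
    Submodule (MvPolynomial (Fin 3) K) (Fin (2 * c + 2) → MvPolynomial (Fin 3) K) :=
  LinearMap.ker (AcPoly K c).mulVecLin


section helpers

variable {R : Type*} [CommRing R]

/-- extension by zero of a finite sequence -/
def fext {N : ℕ} (f : Fin N → R) (k : ℕ) : R := if h : k < N then f ⟨k, h⟩ else 0

/-- value of a vector at a 1-based column -/
def colv {N : ℕ} (m : Fin N → R) (j : ℕ) : R :=
  if h : 1 ≤ j ∧ j ≤ N then m ⟨j - 1, by omega⟩ else 0

lemma colv_succ {N : ℕ} (m : Fin N → R) (j : Fin N) : colv m (j.1 + 1) = m j := by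
  have h : 1 ≤ j.1 + 1 ∧ j.1 + 1 ≤ N := by omega
  simp [colv, h]

lemma colv_mk {N : ℕ} (g : ℕ → R) (j : ℕ) (h1 : 1 ≤ j) (h2 : j ≤ N) :
    colv (fun k : Fin N => g (k.1 + 1)) j = g j := by
  simp only [colv, h1, h2, and_self, dif_pos]
  congr 1; omega

lemma sum_ite_colv {N : ℕ} (m : Fin N → R) (a : R) (k : ℕ) :
    ∑ j : Fin N, (if j.1 + 1 = k then a else 0) * m j = a * colv m k := by
  by_cases h : 1 ≤ k ∧ k ≤ N
  · rw [Finset.sum_eq_single (⟨k - 1, by omega⟩ : Fin N)]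
    · have : k - 1 + 1 = k := by omega
      simp [colv, h, this]
    · intro b _ hb
      have : b.1 + 1 ≠ k := by
        intro h'; apply hb; ext; simp; omega
      simp [this]
    · simp
  · rw [colv, dif_neg h, mul_zero]
    apply Finset.sum_eq_zero
    intro j _
    have : j.1 + 1 ≠ k := by
      intro h'; apply h; have := j.2; omega
    simp [this]

lemma sum_ite_fext {N : ℕ} (f : Fin N → R) (k : ℕ) :
    ∑ j : Fin N, f j * (if k = j.1 then 1 else 0) = fext f k := by
  by_cases h : k < N
  · rw [Finset.sum_eq_single (⟨k, h⟩ : Fin N)]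
    · simp [fext, h]
    · intro b _ hb
      have : k ≠ b.1 := by
        intro h'; apply hb; ext; simp; omega
      simp [this]
    · simp
  · rw [fext, dif_neg h]
    apply Finset.sum_eq_zero
    intro j _
    have : k ≠ j.1 := by
      intro h'; apply h; have := j.2; omega
    simp [this]

/-- the row equations -/
def RowEqs (x y t : R) (c : ℕ) (M : ℕ → R) : Prop :=
  (x * M 1 + y * M 2 + t * M 3 = 0) ∧ (x * M 4 + y * M 5 + t * M 6 = 0) ∧
  ∀ i, 3 ≤ i → i ≤ c →
    x * M (pcol i) + y * M (qcol i) + t * (M (pcol (i - 2)) + M (qcol (i - 1))) = 0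

lemma mulVec_row (c : ℕ) (p : Fin 3 → R) (m : Fin (2 * c + 2) → R) (i : Fin c) :
    (Ac c p).mulVec m i =
      if i.1 + 1 ≤ 2 then
        p 0 * colv m (pcol (i.1 + 1)) + p 1 * colv m (qcol (i.1 + 1)) +
          p 2 * colv m (qcol (i.1 + 1) + 1)
      else p 0 * colv m (2 * (i.1 + 1) + 1) + p 1 * colv m (2 * (i.1 + 1) + 2) +
        p 2 * colv m (pcol (i.1 + 1 - 2)) + p 2 * colv m (qcol (i.1 + 1 - 1)) := by
  simp only [Matrix.mulVec, dotProduct, Ac, AcEnt]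
  split_ifs with h
  · simp only [add_mul, Finset.sum_add_distrib, sum_ite_colv]
  · simp only [add_mul, Finset.sum_add_distrib, sum_ite_colv]

lemma rowEqs_iff (c : ℕ) (hc : 5 ≤ c) (p : Fin 3 → R) (m : Fin (2 * c + 2) → R) :
    (Ac c p).mulVec m = 0 ↔ RowEqs (p 0) (p 1) (p 2) c (colv m) := by
  constructor
  · intro h
    refine ⟨?_, ?_, ?_⟩
    · have := congrFun h ⟨0, by omega⟩
      rw [mulVec_row] at this
      simpa [pcol, qcol] using this
    · have := congrFun h ⟨1, by omega⟩
      rw [mulVec_row] at this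
      simpa [pcol, qcol] using this
    · intro i h3 hi
      have := congrFun h ⟨i - 1, by omega⟩
      rw [mulVec_row] at this
      have e : i - 1 + 1 = i := by omega
      simp only [e] at this
      rw [if_neg (by omega)] at this
      have e1 : pcol i = 2 * i + 1 := by
        rw [pcol, if_neg (by omega), if_neg (by omega)]
      have e2 : qcol i = 2 * i + 2 := by rw [qcol, e1]
      rw [e1, e2]
      simp only [Pi.zero_apply] at this
      linear_combination this
  · rintro ⟨h1, h2, h3⟩
    funext i
    rw [mulVec_row]
    obtain ⟨i, hi⟩ := i
    rcases i with _ | _ | i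
    · simpa [pcol, qcol] using h1
    · simpa [pcol, qcol] using h2
    · have := h3 (i + 2 + 1) (by omega) (by omega)
      simp only
      rw [if_neg (by omega)]
      have e1 : pcol (i + 2 + 1) = 2 * (i + 2 + 1) + 1 := by
        rw [pcol, if_neg (by omega), if_neg (by omega)]
      have e2 : qcol (i + 2 + 1) = 2 * (i + 2 + 1) + 2 := by rw [qcol, e1]
      rw [e1, e2] at this
      simp only [Pi.zero_apply]
      linear_combination this

lemma col_cases (c j : ℕ) (h1 : 1 ≤ j) (h2 : j ≤ 2 * c + 2) (hc : 5 ≤ c) :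
    j = 3 ∨ j = 6 ∨ ∃ i, 1 ≤ i ∧ i ≤ c ∧ (j = pcol i ∨ j = qcol i) := by
  by_cases h7 : 7 ≤ j
  · right; right
    refine ⟨(j - 1) / 2, by omega, by omega, ?_⟩
    rw [qcol, pcol, if_neg (by omega), if_neg (by omega)]
    omega
  · have : j = 1 ∨ j = 2 ∨ j = 3 ∨ j = 4 ∨ j = 5 ∨ j = 6 := by omega
    rcases this with rfl | rfl | rfl | rfl | rfl | rfl
    · right; right; exact ⟨1, by omega, by omega, Or.inl rfl⟩
    · right; right; exact ⟨1, by omega, by omega, Or.inr rfl⟩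
    · left; rfl
    · right; right; exact ⟨2, by omega, by omega, Or.inl rfl⟩
    · right; right; exact ⟨2, by omega, by omega, Or.inr rfl⟩
    · right; left; rfl

lemma pcol_le (c i : ℕ) (h1 : 1 ≤ i) (h2 : i ≤ c) (hc : 5 ≤ c) :
    1 ≤ pcol i ∧ pcol i + 1 ≤ 2 * c + 2 := by
  unfold pcol; split_ifs <;> omega

/-- the vector attached to a sequence -/
def Vc (x y t : R) (f : ℕ → R) (j : ℕ) : R :=
  if j = 1 then y * f 2 + t * f 1
  else if j = 2 then (-x) * f 2 + (-t) * f 0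
  else if j = 3 then (-x) * f 1 + y * f 0
  else if j = 4 then y * f 3 + t * f 2
  else if j = 5 then (-x) * f 3 + (-t) * f 1
  else if j = 6 then (-x) * f 2 + y * f 1
  else if j % 2 = 1 then y * f (j / 2 + 1) + t * f (j / 2)
  else (-x) * f (j / 2) + (-t) * f (j / 2 - 2)

lemma Vc_p (x y t : R) (f : ℕ → R) (i : ℕ) (hi : 1 ≤ i) :
    Vc x y t f (pcol i) = y * f (i + 1) + t * f i := by
  unfold pcol
  split_ifs with h1 h2
  · subst h1; simp [Vc]
  · subst h2; simp [Vc]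
  · rw [Vc, if_neg (by omega), if_neg (by omega), if_neg (by omega), if_neg (by omega),
      if_neg (by omega), if_neg (by omega), if_pos (by omega)]
    have : (2 * i + 1) / 2 = i := by omega
    rw [this]

lemma Vc_q (x y t : R) (f : ℕ → R) (i : ℕ) (hi : 1 ≤ i) :
    Vc x y t f (qcol i) = (-x) * f (i + 1) + (-t) * f (i - 1) := by
  unfold qcol pcol
  split_ifs with h1 h2
  · subst h1; simp [Vc]
  · subst h2; simp [Vc]
  · rw [Vc, if_neg (by omega), if_neg (by omega), if_neg (by omega), if_neg (by omega),
      if_neg (by omega), if_neg (by omega), if_neg (by omega)]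
    have e1 : (2 * i + 1 + 1) / 2 = i + 1 := by omega
    have e2 : i + 1 - 2 = i - 1 := by omega
    rw [e1, e2]

lemma Vc_3 (x y t : R) (f : ℕ → R) : Vc x y t f 3 = (-x) * f 1 + y * f 0 := by simp [Vc]
lemma Vc_6 (x y t : R) (f : ℕ → R) : Vc x y t f 6 = (-x) * f 2 + y * f 1 := by simp [Vc]

lemma Vc_sum {N : ℕ} (x y t : R) (f : Fin N → R) (e : Fin N → ℕ → R) (j : ℕ) :
    ∑ k, f k * Vc x y t (e k) j = Vc x y t (fun l => ∑ k, f k * e k l) j := by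
  have key : ∀ (p q : R) (a b : ℕ), ∑ k, f k * (p * e k a + q * e k b) =
      p * ∑ k, f k * e k a + q * ∑ k, f k * e k b := by
    intro p q a b
    rw [Finset.mul_sum, Finset.mul_sum, ← Finset.sum_add_distrib]
    apply Finset.sum_congr rfl
    intro k _
    ring
  unfold Vc
  split_ifs <;> exact key _ _ _ _

lemma Vc_rowEqs (x y t : R) (f : ℕ → R) (c : ℕ) : RowEqs x y t c (Vc x y t f) := by
  refine ⟨?_, ?_, ?_⟩
  · simp [Vc]; ring
  · simp [Vc]; ring
  · intro i h3 hi
    rw [Vc_p _ _ _ _ _ (by omega), Vc_q _ _ _ _ _ (by omega), Vc_p _ _ _ _ _ (by omega),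
      Vc_q _ _ _ _ _ (by omega)]
    have e1 : i - 2 + 1 = i - 1 := by omega
    have e2 : i - 1 + 1 = i := by omega
    have e3 : i - 1 - 1 = i - 2 := by omega
    rw [e1, e2, e3]; ring

/-- `a`-coordinates of the special syzygy -/
def wa (x t : R) (n i : ℕ) : R :=
  if i % 2 = 0 then t ^ (i / 2) * (-x) ^ (n - 1 - i / 2) else 0

/-- the special syzygy -/
def Wc (x t : R) (n j : ℕ) : R :=
  if j = 6 then wa x t n 0
  else if j = 4 then wa x t n 2
  else if 7 ≤ j ∧ j % 2 = 1 then wa x t n (j / 2) else 0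

lemma Wc_p (x t : R) (n i : ℕ) (hi : 1 ≤ i) : Wc x t n (pcol i) = wa x t n i := by
  unfold pcol
  split_ifs with h1 h2
  · subst h1; simp [Wc, wa]
  · subst h2; simp [Wc]
  · rw [Wc, if_neg (by omega), if_neg (by omega), if_pos (by omega)]
    have : (2 * i + 1) / 2 = i := by omega
    rw [this]

lemma Wc_q (x t : R) (n i : ℕ) (hi : 1 ≤ i) : Wc x t n (qcol i) = 0 := by
  unfold qcol pcol
  split_ifs with h1 h2
  · subst h1; simp [Wc]
  · subst h2; simp [Wc]
  · rw [Wc, if_neg (by omega), if_neg (by omega), if_neg (by omega)]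

lemma wa_rec (x t : R) (n i : ℕ) (hi : i + 2 ≤ 2 * n - 1) :
    x * wa x t n (i + 2) + t * wa x t n i = 0 := by
  unfold wa
  by_cases h : i % 2 = 0
  · rw [if_pos h, if_pos (by omega)]
    obtain ⟨k, rfl⟩ : ∃ k, i = 2 * k := ⟨i / 2, by omega⟩
    obtain ⟨d, rfl⟩ : ∃ d, n = k + 2 + d := ⟨n - k - 2, by omega⟩
    have e1 : (2 * k + 2) / 2 = k + 1 := by omega
    have e2 : 2 * k / 2 = k := by omega
    have e3 : k + 2 + d - 1 - (k + 1) = d := by omega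
    have e4 : k + 2 + d - 1 - k = d + 1 := by omega
    rw [e1, e2, e3, e4]; ring
  · rw [if_neg h, if_neg (by omega)]; ring

lemma Wc_rowEqs (x y t : R) (n : ℕ) (hn : 3 ≤ n) : RowEqs x y t (2 * n - 1) (Wc x t n) := by
  refine ⟨?_, ?_, ?_⟩
  · simp [Wc]
  · have := wa_rec x t n 0 (by omega)
    simp [Wc]
    simpa using this
  · intro i h3 hi
    rw [Wc_p _ _ _ _ (by omega), Wc_q _ _ _ _ (by omega), Wc_p _ _ _ _ (by omega),
      Wc_q _ _ _ _ (by omega)]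
    have := wa_rec x t n (i - 2) (by omega)
    have e1 : i - 2 + 2 = i := by omega
    rw [e1] at this
    linear_combination this

/-- coefficients of the relation -/
def Fc (x y t : R) (n k : ℕ) : R :=
  if k % 2 = 0 then t ^ (k / 2) * (-x) ^ (n - k / 2)
  else -y * t ^ (k / 2) * (-x) ^ (n - 1 - k / 2)

lemma Fc_two (x y t : R) (n k : ℕ) (hk : k + 2 ≤ 2 * n) :
    x * Fc x y t n (k + 2) + t * Fc x y t n k = 0 := by
  unfold Fc
  obtain ⟨d, rfl⟩ : ∃ d, n = k / 2 + 1 + d := ⟨n - k / 2 - 1, by omega⟩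
  have e1 : (k + 2) / 2 = k / 2 + 1 := by omega
  have e5 : (k + 2) % 2 = k % 2 := by omega
  rw [e1, e5]
  have e3 : k / 2 + 1 + d - (k / 2 + 1) = d := by omega
  have e4 : k / 2 + 1 + d - k / 2 = d + 1 := by omega
  have e6 : k / 2 + 1 + d - 1 - k / 2 = d := by omega
  rw [e3, e4, e6]
  split_ifs with h
  · ring
  · obtain ⟨d', rfl⟩ : ∃ d', d = d' + 1 := ⟨d - 1, by omega⟩
    have e7 : k / 2 + 1 + (d' + 1) - 1 - (k / 2 + 1) = d' := by omega
    rw [e7]; ring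

lemma Fc_one (x y t : R) (n k : ℕ) (hk : k + 1 ≤ 2 * n) :
    y * Fc x y t n (k + 1) + t * Fc x y t n k = -(y ^ 2 + x * t) * wa x t n k := by
  unfold Fc wa
  by_cases h : k % 2 = 0
  · rw [if_pos h, if_pos h, if_neg (by omega)]
    obtain ⟨d, rfl⟩ : ∃ d, n = k / 2 + 1 + d := ⟨n - k / 2 - 1, by omega⟩
    have e1 : (k + 1) / 2 = k / 2 := by omega
    rw [e1]
    have e4 : k / 2 + 1 + d - k / 2 = d + 1 := by omega
    have e6 : k / 2 + 1 + d - 1 - k / 2 = d := by omega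
    rw [e4, e6]; ring
  · rw [if_neg h, if_neg h, if_pos (by omega)]
    obtain ⟨d, rfl⟩ : ∃ d, n = k / 2 + 1 + d := ⟨n - k / 2 - 1, by omega⟩
    have e1 : (k + 1) / 2 = k / 2 + 1 := by omega
    rw [e1]
    have e4 : k / 2 + 1 + d - (k / 2 + 1) = d := by omega
    have e6 : k / 2 + 1 + d - 1 - k / 2 = d := by omega
    rw [e4, e6]; ring

/-- two vectors agreeing on the named columns agree -/
lemma eq_on_cols (c : ℕ) (hc : 5 ≤ c) (M N : ℕ → R) (h3 : M 3 = N 3) (h6 : M 6 = N 6)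
    (hp : ∀ i, 1 ≤ i → i ≤ c → M (pcol i) = N (pcol i))
    (hq : ∀ i, 1 ≤ i → i ≤ c → M (qcol i) = N (qcol i)) (j : ℕ) (h1 : 1 ≤ j)
    (h2 : j ≤ 2 * c + 2) : M j = N j := by
  rcases col_cases c j h1 h2 hc with rfl | rfl | ⟨i, hi, hi', rfl | rfl⟩
  · exact h3
  · exact h6
  · exact hp i hi hi'
  · exact hq i hi hi'

lemma relation_cols (x y t : R) (n : ℕ) (hn : 3 ≤ n) (j : ℕ) (h1 : 1 ≤ j)
    (h2 : j ≤ 2 * (2 * n - 1) + 2) :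
    Vc x y t (Fc x y t n) j + (y ^ 2 + x * t) * Wc x t n j = 0 := by
  refine eq_on_cols (2 * n - 1) (by omega)
    (fun j => Vc x y t (Fc x y t n) j + (y ^ 2 + x * t) * Wc x t n j) (fun _ => 0)
    ?_ ?_ ?_ ?_ j h1 h2
  · have e : Wc x t n 3 = 0 := by simp [Wc]
    simp only [Vc_3, e]
    obtain ⟨d, rfl⟩ : ∃ d, n = d + 1 := ⟨n - 1, by omega⟩
    simp [Fc]; ring
  · have e : Wc x t n 6 = wa x t n 0 := by simp [Wc]
    simp only [Vc_6, e]
    have a := Fc_one x y t n 0 (by omega)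
    have b := Fc_two x y t n 0 (by omega)
    simp only [zero_add] at a b
    linear_combination a - b
  · intro i hi hi'
    simp only [Vc_p _ _ _ _ _ hi, Wc_p _ _ _ _ hi]
    have a := Fc_one x y t n i (by omega)
    linear_combination a
  · intro i hi hi'
    simp only [Vc_q _ _ _ _ _ hi, Wc_q _ _ _ _ hi]
    have b := Fc_two x y t n (i - 1) (by omega)
    have e : i - 1 + 2 = i + 1 := by omega
    rw [e] at b
    linear_combination -b

/-- the coefficients `P` with `G m = ∑ P_k v_k` -/
def Pc (x y t : R) (M : ℕ → R) (k : ℕ) : R :=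
  if k = 0 then y * M 3 + x * M 6 - x * M 2
  else if k = 1 then y * M 6 + x * M 1
  else if k = 2 then y * M 1 - t * M 6
  else y * M (pcol (k - 1)) - t * M (pcol (k - 2)) - t * M (qcol (k - 1))

lemma Pc_one (x y t : R) (c : ℕ) (M : ℕ → R) (hM : RowEqs x y t c M) (hc : 5 ≤ c)
    (i : ℕ) (hi : 1 ≤ i) (hi' : i ≤ c) :
    y * Pc x y t M (i + 1) + t * Pc x y t M i = (y ^ 2 + x * t) * M (pcol i) := by
  obtain ⟨h1, h2, h3⟩ := hM
  rcases i with _ | _ | _ | i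
  · omega
  · simp [Pc, pcol]; ring
  · simp [Pc, pcol, qcol]; linear_combination (-t) * h2
  · have := h3 (i + 3) (by omega) hi'
    simp only [show i + 1 + 1 + 1 = i + 3 by rfl, Pc]
    simp only [show i + 3 + 1 ≠ 0 by omega, show i + 3 + 1 ≠ 1 by omega,
      show i + 3 + 1 ≠ 2 by omega, show i + 3 ≠ 0 by omega, show i + 3 ≠ 1 by omega,
      show i + 3 ≠ 2 by omega, if_false, show i + 3 + 1 - 1 = i + 3 by omega,
      show i + 3 + 1 - 2 = i + 2 by omega, show i + 3 - 1 = i + 2 by omega,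
      show i + 3 - 2 = i + 1 by omega] at this ⊢
    linear_combination (-t) * this

lemma Pc_zero (x y t : R) (c : ℕ) (M : ℕ → R) (hM : RowEqs x y t c M) :
    y * Pc x y t M 1 + t * Pc x y t M 0 = (y ^ 2 + x * t) * (M 6 - M 2) := by
  obtain ⟨h1, h2, h3⟩ := hM
  simp [Pc]; linear_combination y * h1

lemma Pc_two (x y t : R) (c : ℕ) (M : ℕ → R) (hM : RowEqs x y t c M) (hc : 5 ≤ c)
    (i : ℕ) (hi : 1 ≤ i) (hi' : i ≤ c) :
    (-x) * Pc x y t M (i + 1) + (-t) * Pc x y t M (i - 1) =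
      (y ^ 2 + x * t) * M (qcol i) := by
  obtain ⟨h1, h2, h3⟩ := hM
  rcases i with _ | _ | _ | _ | i
  · omega
  · simp [Pc, pcol, qcol]; linear_combination (-y) * h1
  · simp [Pc, pcol, qcol]; linear_combination (-y) * h2
  · have := h3 3 (by omega) hi'
    simp [Pc, pcol, qcol] at this ⊢; linear_combination (-y) * this + t * h2
  · have := h3 (i + 4) (by omega) hi'
    have h' := h3 (i + 3) (by omega) (by omega)
    simp only [show i + 1 + 1 + 1 + 1 = i + 4 by rfl, Pc]
    simp only [show i + 4 + 1 ≠ 0 by omega, show i + 4 + 1 ≠ 1 by omega,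
      show i + 4 + 1 ≠ 2 by omega, show i + 3 ≠ 0 by omega, show i + 3 ≠ 1 by omega,
      show i + 3 ≠ 2 by omega, if_false, show i + 4 + 1 - 1 = i + 4 by omega,
      show i + 4 + 1 - 2 = i + 3 by omega, show i + 4 - 1 = i + 3 by omega,
      show i + 4 - 2 = i + 2 by omega, show i + 3 - 1 = i + 2 by omega,
      show i + 3 - 2 = i + 1 by omega] at this h' ⊢
    linear_combination (-y) * this + t * h'

lemma Pc_cols (x y t : R) (c : ℕ) (M : ℕ → R) (hM : RowEqs x y t c M) (hc : 5 ≤ c)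
    (j : ℕ) (h1 : 1 ≤ j) (h2 : j ≤ 2 * c + 2) :
    Vc x y t (Pc x y t M) j = (y ^ 2 + x * t) * M j := by
  refine eq_on_cols c hc (fun j => Vc x y t (Pc x y t M) j)
    (fun j => (y ^ 2 + x * t) * M j) ?_ ?_ ?_ ?_ j h1 h2
  · obtain ⟨h1, h2, h3⟩ := hM
    simp only [Vc_3]
    simp [Pc]; linear_combination (-x) * h1
  · simp only [Vc_6]
    simp [Pc]; ring
  · intro i hi hi'
    simp only [Vc_p _ _ _ _ _ hi]
    exact Pc_one x y t c M hM hc i hi hi'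
  · intro i hi hi'
    simp only [Vc_q _ _ _ _ _ hi]
    exact Pc_two x y t c M hM hc i hi hi'

lemma pow_chain (x t G : R) (P : ℕ → R) (n : ℕ)
    (h : ∀ k, k + 2 ≤ 2 * n → G ∣ x * P (k + 2) + t * P k) (k : ℕ) (hk : k ≤ n) :
    G ∣ t ^ k * P 0 - (-x) ^ k * P (2 * k) := by
  induction k with
  | zero => simp
  | succ k ih =>
    obtain ⟨u, hu⟩ := ih (by omega)
    obtain ⟨v, hv⟩ := h (2 * k) (by omega)
    refine ⟨t * u + (-x) ^ k * v, ?_⟩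
    rw [show 2 * (k + 1) = 2 * k + 2 by ring]
    linear_combination t * hu + (-x) ^ k * hv

end helpers

section poly

variable {K : Type*} [Field K]

local notation "S" => MvPolynomial (Fin 3) K
local notation "xx" => (X 0 : MvPolynomial (Fin 3) K)
local notation "yy" => (X 1 : MvPolynomial (Fin 3) K)
local notation "tt" => (X 2 : MvPolynomial (Fin 3) K)

lemma tt_prime : Prime tt := MvPolynomial.X_prime
lemma yy_prime : Prime yy := MvPolynomial.X_prime

lemma tt_not_dvd : ¬ tt ∣ yy ^ 2 + xx * tt := by
  rintro ⟨u, hu⟩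
  have := congrArg (MvPolynomial.eval (fun i : Fin 3 => if i = 1 then (1 : K) else 0)) hu
  simp at this

lemma yy_not_dvd (n : ℕ) : ¬ yy ∣ xx ^ n := by
  rintro ⟨u, hu⟩
  have := congrArg (MvPolynomial.eval (fun i : Fin 3 => if i = 0 then (1 : K) else 0)) hu
  simp at this

lemma G_ne : yy ^ 2 + xx * tt ≠ 0 := by
  intro h
  exact tt_not_dvd (K := K) (h ▸ dvd_zero _)

lemma cancel_t (z : S) (h : yy ^ 2 + xx * tt ∣ tt * z) : yy ^ 2 + xx * tt ∣ z := by
  obtain ⟨u, hu⟩ := h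
  have : tt ∣ (yy ^ 2 + xx * tt) * u := ⟨z, hu.symm⟩
  rcases (tt_prime (K := K)).dvd_or_dvd this with h | ⟨v, rfl⟩
  · exact absurd h tt_not_dvd
  · refine ⟨v, mul_left_cancel₀ (tt_prime (K := K)).ne_zero ?_⟩
    linear_combination hu

lemma cancel_t_pow (n : ℕ) (z : S) (h : yy ^ 2 + xx * tt ∣ tt ^ n * z) :
    yy ^ 2 + xx * tt ∣ z := by
  induction n with
  | zero => simpa using h
  | succ n ih =>
    apply ih; apply cancel_t
    rwa [← mul_assoc, ← pow_succ']

/-- setting `t = 0` -/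
noncomputable def sg : S →ₐ[K] S := aeval (fun i : Fin 3 => if i = 2 then 0 else X i)

lemma sg_dvd (p : S) : tt ∣ p - sg p := by
  induction p using MvPolynomial.induction_on with
  | C a => simp [sg]
  | add p q hp hq =>
    have : p + q - sg (p + q) = (p - sg p) + (q - sg q) := by rw [map_add]; ring
    rw [this]; exact dvd_add hp hq
  | mul_X p i hp =>
    have : p * X i - sg (p * X i) = (p - sg p) * X i + sg p * (X i - sg (X i)) := by
      rw [map_mul]; ring
    rw [this]
    refine dvd_add (Dvd.dvd.mul_right hp _) (Dvd.dvd.mul_left ?_ _)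
    by_cases h : i = 2
    · subst h; simp [sg]
    · simp [sg, h]

lemma key_dvd (n : ℕ) (A B C : S)
    (h : tt * A = (-xx) ^ n * B + (yy ^ 2 + xx * tt) * C) :
    ∃ g : S, yy ^ 2 + xx * tt ∣ B - tt * g := by
  have h0 := congrArg sg h
  have st : sg tt = 0 := by simp [sg]
  have sx : sg xx = xx := by simp [sg]
  have sy : sg yy = yy := by simp [sg]
  simp only [map_add, map_mul, map_pow, map_neg, st, sx, sy] at h0
  have hd : yy ^ 2 ∣ (xx ^ n) * sg B := by
    refine ⟨- (-1) ^ n * sg C, ?_⟩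
    have e : (-xx) ^ n = (-1) ^ n * xx ^ n := by rw [neg_pow]
    have e2 : ((-1 : S) ^ n) * (-1) ^ n = 1 := by rw [← mul_pow]; simp
    rw [e] at h0
    linear_combination (-(-1 : S) ^ n) * h0 - xx ^ n * sg B * e2
  have hd2 : yy ^ 2 ∣ sg B := (yy_prime (K := K)).pow_dvd_of_dvd_mul_left 2 (yy_not_dvd n) hd
  obtain ⟨D, hD⟩ := hd2
  obtain ⟨E, hE⟩ := sg_dvd B
  refine ⟨E - xx * D, D, ?_⟩
  linear_combination hE + hD

lemma key_pow (m n : ℕ) (A B : S)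
    (h : yy ^ 2 + xx * tt ∣ tt ^ n * A - (-xx) ^ m * B) :
    ∃ g : S, yy ^ 2 + xx * tt ∣ B - tt ^ n * g := by
  induction n generalizing B with
  | zero => exact ⟨B, by simp⟩
  | succ n ih =>
    obtain ⟨C, hC⟩ := h
    obtain ⟨g, u, hu⟩ := key_dvd m (tt ^ n * A) B C (by rw [pow_succ] at hC; linear_combination hC)
    have : yy ^ 2 + xx * tt ∣ tt * (tt ^ n * A - (-xx) ^ m * g) := by
      refine ⟨C + (-xx) ^ m * u, ?_⟩
      rw [pow_succ] at hC
      linear_combination hC + (-xx) ^ m * hu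
    obtain ⟨g', v, hv⟩ := ih g (cancel_t _ this)
    refine ⟨g', u + tt * v, ?_⟩
    rw [pow_succ]
    linear_combination hu + tt * hv

lemma exists_g (n : ℕ) (hn : 3 ≤ n) (M : ℕ → S) (hM : RowEqs xx yy tt (2 * n - 1) M) :
    ∃ g : S, ∀ k, k ≤ 2 * n →
      yy ^ 2 + xx * tt ∣ Pc xx yy tt M k - g * Fc xx yy tt n k := by
  have h2 := pow_chain xx tt (yy ^ 2 + xx * tt) (Pc xx yy tt M) n (by
    intro k hk
    have := Pc_two xx yy tt _ M hM (by omega) (k + 1) (by omega) (by omega)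
    simp only [Nat.add_sub_cancel] at this
    exact ⟨- M (qcol (k + 1)), by linear_combination -this⟩) n le_rfl
  obtain ⟨g, hg⟩ := key_pow n n _ _ h2
  refine ⟨g, fun k hk => ?_⟩
  obtain ⟨d, rfl⟩ : ∃ d, k = 2 * n - d := ⟨2 * n - k, by omega⟩
  induction d with
  | zero =>
    have e : 2 * n / 2 = n := by omega
    simp only [Nat.sub_zero, Fc, e]
    rw [if_pos (by omega), Nat.sub_self, pow_zero, mul_one, mul_comm g]
    exact hg
  | succ d ih =>
    by_cases hd : 2 * n ≤ d
    · have e : 2 * n - (d + 1) = 2 * n - d := by omega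
      rw [e]; exact ih (by omega)
    · obtain ⟨u, hu⟩ := ih (by omega)
      have hF := Fc_one xx yy tt n (2 * n - (d + 1)) (by omega)
      have e : 2 * n - (d + 1) + 1 = 2 * n - d := by omega
      rw [e] at hF
      have hP : ∃ z, yy * Pc xx yy tt M (2 * n - d) + tt * Pc xx yy tt M (2 * n - (d + 1)) =
          (yy ^ 2 + xx * tt) * z := by
        by_cases h0 : 2 * n - (d + 1) = 0
        · have h1 : 2 * n - d = 1 := by omega
          rw [h0, h1]; exact ⟨_, Pc_zero _ _ _ _ M hM⟩
        · have := Pc_one xx yy tt _ M hM (by omega) (2 * n - (d + 1)) (by omega) (by omega)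
          rw [e] at this
          exact ⟨_, this⟩
      obtain ⟨z, hz⟩ := hP
      apply cancel_t
      refine ⟨z + g * wa xx tt n (2 * n - (d + 1)) - yy * u, ?_⟩
      linear_combination hz - g * hF - yy * hu

lemma Vc_inj (c : ℕ) (hc : 5 ≤ c) (f : ℕ → S)
    (h : ∀ j, 1 ≤ j → j ≤ 2 * c + 2 → Vc xx yy tt f j = 0) (k : ℕ) (hk : k ≤ c + 1) :
    f k = 0 := by
  have h1 : ∀ i, 1 ≤ i → i ≤ c → yy * f (i + 1) + tt * f i = 0 := by
    intro i hi hi'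
    have := pcol_le c i hi hi' hc
    rw [← Vc_p xx yy tt f i hi]; exact h _ (by omega) (by omega)
  have h2 : ∀ i, 1 ≤ i → i ≤ c → (-xx) * f (i + 1) + (-tt) * f (i - 1) = 0 := by
    intro i hi hi'
    have := pcol_le c i hi hi' hc
    rw [← Vc_q xx yy tt f i hi]; exact h _ (by unfold qcol; omega) (by unfold qcol; omega)
  have h3 : ∀ i, 3 ≤ i → i ≤ c + 1 → f i = 0 := by
    intro i hi hi'
    have a := h1 (i - 1) (by omega) (by omega)
    have b := h1 (i - 2) (by omega) (by omega)
    have d := h2 (i - 1) (by omega) (by omega)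
    rw [show i - 1 + 1 = i by omega] at a d
    rw [show i - 2 + 1 = i - 1 by omega] at b
    rw [show i - 1 - 1 = i - 2 by omega] at d
    have : (yy ^ 2 + xx * tt) * f i = 0 := by
      linear_combination yy * a - tt * b - tt * d
    exact (mul_eq_zero.mp this).resolve_left G_ne
  by_cases hk3 : 3 ≤ k
  · exact h3 k hk3 hk
  · have h4 : ∀ i, 1 ≤ i → i ≤ c → f (i + 1) = 0 → f (i - 1) = 0 := by
      intro i hi hi' h0
      have d := h2 i hi hi'
      have : tt * f (i - 1) = 0 := by rw [h0] at d; linear_combination -d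
      exact (mul_eq_zero.mp this).resolve_left (tt_prime (K := K)).ne_zero
    have f3 := h3 3 (by omega) (by omega)
    have f4 := h3 4 (by omega) (by omega)
    have f2 := h4 3 (by omega) (by omega) f4
    have f1 := h4 2 (by omega) (by omega) f3
    have f0 := h4 1 (by omega) (by omega) f2
    have : k = 0 ∨ k = 1 ∨ k = 2 := by omega
    rcases this with rfl | rfl | rfl <;> assumption

lemma Vc_hom (x y t : S) (hx : x.IsHomogeneous 1) (hy : y.IsHomogeneous 1)
    (ht : t.IsHomogeneous 1) (f : ℕ → S) (hf : ∀ k, (f k).IsHomogeneous 0) (j : ℕ) :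
    (Vc x y t f j).IsHomogeneous 1 := by
  have key : ∀ p q : S, p.IsHomogeneous 1 → q.IsHomogeneous 1 → ∀ a b,
      (p * f a + q * f b).IsHomogeneous 1 := fun p q hp hq a b =>
    (hp.mul (hf a)).add (hq.mul (hf b))
  unfold Vc
  split_ifs <;> apply key <;> first | assumption | (apply IsHomogeneous.neg; assumption)

lemma negx_hom (d : ℕ) : ((-xx) ^ d).IsHomogeneous d := by
  simpa using ((isHomogeneous_X K (0 : Fin 3)).neg).pow d

lemma t_hom (d : ℕ) : (tt ^ d).IsHomogeneous d := by
  simpa using (isHomogeneous_X K (2 : Fin 3)).pow d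

lemma wa_hom (n i : ℕ) (hi : i ≤ 2 * n - 1) (hn : 1 ≤ n) :
    (wa xx tt n i).IsHomogeneous (n - 1) := by
  unfold wa
  split_ifs with h
  · have := (t_hom (K := K) (i / 2)).mul (negx_hom (n - 1 - i / 2))
    rwa [show i / 2 + (n - 1 - i / 2) = n - 1 by omega] at this
  · exact isHomogeneous_zero _ _ _

lemma Wc_hom (n j : ℕ) (hn : 3 ≤ n) (hj : j ≤ 4 * n) :
    (Wc xx tt n j).IsHomogeneous (n - 1) := by
  unfold Wc
  split_ifs with h1 h2 h3
  · exact wa_hom _ _ (by omega) (by omega)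
  · exact wa_hom _ _ (by omega) (by omega)
  · exact wa_hom _ _ (by omega) (by omega)
  · exact isHomogeneous_zero _ _ _

lemma Fc_hom (n k : ℕ) (hk : k ≤ 2 * n) : (Fc xx yy tt n k).IsHomogeneous n := by
  unfold Fc
  split_ifs with h
  · have := (t_hom (K := K) (k / 2)).mul (negx_hom (n - k / 2))
    rwa [show k / 2 + (n - k / 2) = n by omega] at this
  · have := (((isHomogeneous_X K (1 : Fin 3)).neg).mul (t_hom (K := K) (k / 2))).mul
      (negx_hom (n - 1 - k / 2))
    rwa [show 1 + k / 2 + (n - 1 - k / 2) = n by omega] at this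

lemma mem_syz (c : ℕ) (hc : 5 ≤ c) (m : Fin (2 * c + 2) → S) :
    m ∈ syzMod K c ↔ RowEqs xx yy tt c (colv m) := by
  rw [syzMod, LinearMap.mem_ker, Matrix.mulVecLin_apply, AcPoly, rowEqs_iff c hc]

lemma RowEqs_congr (c : ℕ) (hc : 5 ≤ c) (x y t : S) (M N : ℕ → S)
    (h : ∀ j, 1 ≤ j → j ≤ 2 * c + 2 → M j = N j) (hN : RowEqs x y t c N) :
    RowEqs x y t c M := by
  obtain ⟨h1, h2, h3⟩ := hN
  refine ⟨?_, ?_, ?_⟩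
  · rw [h 1 (by omega) (by omega), h 2 (by omega) (by omega), h 3 (by omega) (by omega), h1]
  · rw [h 4 (by omega) (by omega), h 5 (by omega) (by omega), h 6 (by omega) (by omega), h2]
  · intro i hi hi'
    have b1 := pcol_le c i (by omega) (by omega) hc
    have b2 := pcol_le c (i - 1) (by omega) (by omega) hc
    have b3 := pcol_le c (i - 2) (by omega) (by omega) hc
    have := h3 i hi hi'
    unfold qcol at *
    rw [h _ (by omega) (by omega), h _ (by omega) b1.2, h (pcol (i - 2)) (by omega) (by omega),
      h (pcol (i - 1) + 1) (by omega) (by omega)]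
    exact this

/-- delta sequence -/
noncomputable def dl (k l : ℕ) : S := if l = k then 1 else 0

lemma sum_V (c : ℕ) (f : Fin (c + 2) → S) (j : ℕ) :
    ∑ k, f k * Vc xx yy tt (dl (K := K) k.1) j = Vc xx yy tt (fext f) j := by
  rw [Vc_sum]
  congr 1
  funext l
  exact sum_ite_fext f l

lemma Vc_congr (c : ℕ) (hc : 5 ≤ c) (f g : ℕ → S) (h : ∀ k, k ≤ c + 1 → f k = g k) (j : ℕ)
    (h1 : 1 ≤ j) (h2 : j ≤ 2 * c + 2) : Vc xx yy tt f j = Vc xx yy tt g j := by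
  unfold Vc
  split_ifs <;> (rw [h _ (by omega), h _ (by omega)])

lemma Vc_comb (f g h : ℕ → S) (a b : S) (j : ℕ) (hf : ∀ k, f k = a * g k + b * h k) :
    Vc xx yy tt f j = a * Vc xx yy tt g j + b * Vc xx yy tt h j := by
  unfold Vc
  split_ifs <;> simp only [hf] <;> ring

end poly

/-- **Proposition 20, odd case.** For odd `c ≥ 5` the syzygy module `M_c` of `A_c` is
generated by `c+2` syzygies of degree 1 and one syzygy of degree `(c−1)/2`, whose module
of relations is free of rank one, generated by a single relation with coefficients
homogeneous of degrees `(c+1)/2` and `2`: this is the minimal free resolution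
`0 → O(−(c+3)/2) → O(−(c−1)/2) ⊕ O(−1)^{c+2} → E_c → 0`. -/
theorem stmt13 {K : Type*} [Field K] [IsAlgClosed K] [CharZero K]
    (c : ℕ) (hc : 5 ≤ c) (hodd : Odd c) :
    ∃ (v : Fin (c + 2) → (Fin (2 * c + 2) → MvPolynomial (Fin 3) K))
      (w : Fin (2 * c + 2) → MvPolynomial (Fin 3) K),
      (∀ k j, v k j ∈ homogeneousSubmodule (Fin 3) K 1) ∧
      (∀ j, w j ∈ homogeneousSubmodule (Fin 3) K ((c - 1) / 2)) ∧
      (∀ k, v k ∈ syzMod K c) ∧ w ∈ syzMod K c ∧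
      Submodule.span (MvPolynomial (Fin 3) K) (Set.range v ∪ {w}) = syzMod K c ∧
      ∃ (F : Fin (c + 2) → MvPolynomial (Fin 3) K) (G : MvPolynomial (Fin 3) K),
        (∀ k, F k ∈ homogeneousSubmodule (Fin 3) K ((c + 1) / 2)) ∧
        G ∈ homogeneousSubmodule (Fin 3) K 2 ∧
        (∑ k, F k • v k) + G • w = 0 ∧
        ¬(F = 0 ∧ G = 0) ∧
        (∀ (f : Fin (c + 2) → MvPolynomial (Fin 3) K) (g : MvPolynomial (Fin 3) K),
          (∑ k, f k • v k) + g • w = 0 →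
            ∃ a : MvPolynomial (Fin 3) K, f = a • F ∧ g = a * G) := by
  obtain ⟨n, rfl⟩ : ∃ n, c = 2 * n - 1 := by
    obtain ⟨k, hk⟩ := hodd
    exact ⟨k + 1, by omega⟩
  have hn : 3 ≤ n := by omega
  have en1 : (2 * n - 1 - 1) / 2 = n - 1 := by omega
  have en2 : (2 * n - 1 + 1) / 2 = n := by omega
  have hG := G_ne (K := K)
  set x : MvPolynomial (Fin 3) K := X 0 with hx
  set y : MvPolynomial (Fin 3) K := X 1 with hy
  set t : MvPolynomial (Fin 3) K := X 2 with ht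
  set c := 2 * n - 1 with hcn
  let v : Fin (c + 2) → (Fin (2 * c + 2) → MvPolynomial (Fin 3) K) :=
    fun k j => Vc x y t (dl (K := K) k.1) (j.1 + 1)
  let w : Fin (2 * c + 2) → MvPolynomial (Fin 3) K := fun j => Wc x t n (j.1 + 1)
  let F : Fin (c + 2) → MvPolynomial (Fin 3) K := fun k => Fc x y t n k.1
  have sumv : ∀ (f : Fin (c + 2) → MvPolynomial (Fin 3) K) (j : Fin (2 * c + 2)),
      (∑ k, f k • v k) j = Vc x y t (fext f) (j.1 + 1) := by
    intro f j
    rw [Finset.sum_apply]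
    exact sum_V c f (j.1 + 1)
  have extF : ∀ k, k ≤ c + 1 → fext F k = Fc x y t n k := by
    intro k hk
    rw [fext, dif_pos (by omega)]
  have hrel : (∑ k, F k • v k) + (y ^ 2 + x * t) • w = 0 := by
    funext j
    have hj := j.2
    rw [Pi.add_apply, sumv, Vc_congr c hc _ _ extF _ (by omega) (by omega)]
    exact relation_cols x y t n hn (j.1 + 1) (by omega) (by omega)
  have hv : ∀ k, v k ∈ syzMod K c := by
    intro k
    rw [mem_syz c hc]
    exact RowEqs_congr c hc _ _ _ _ _ (fun j h1 h2 =>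
      colv_mk (fun j => Vc x y t (dl (K := K) k.1) j) j h1 h2) (Vc_rowEqs _ _ _ _ _)
  have hw : w ∈ syzMod K c := by
    rw [mem_syz c hc]
    exact RowEqs_congr c hc _ _ _ _ _ (fun j h1 h2 =>
      colv_mk (fun j => Wc x t n j) j h1 h2) (Wc_rowEqs _ _ _ _ hn)
  refine ⟨v, w, ?_, ?_, hv, hw, ?_, F, y ^ 2 + x * t, ?_, ?_, hrel, ?_, ?_⟩
  · intro k j
    rw [mem_homogeneousSubmodule]
    refine Vc_hom _ _ _ (isHomogeneous_X _ _) (isHomogeneous_X _ _) (isHomogeneous_X _ _) _ ?_ _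
    intro l
    unfold dl
    split_ifs
    · exact isHomogeneous_one _ _
    · exact isHomogeneous_zero _ _ _
  · intro j
    have hj := j.2
    rw [mem_homogeneousSubmodule, en1]
    exact Wc_hom n _ hn (by omega)
  · apply le_antisymm
    · rw [Submodule.span_le]
      rintro m (⟨k, rfl⟩ | rfl)
      · exact hv k
      · exact hw
    · intro m hm
      rw [mem_syz c hc] at hm
      obtain ⟨g, hg⟩ := exists_g n hn (colv m) hm
      choose q hq using hg
      let f : Fin (c + 2) → MvPolynomial (Fin 3) K := fun k => q k.1 (by have := k.2; omega)
      have hf : ∀ k, k ≤ c + 1 → Pc x y t (colv m) k =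
          (y ^ 2 + x * t) * fext f k + g * Fc x y t n k := by
        intro k hk
        have := hq k (by omega)
        rw [fext, dif_pos (by omega)]
        linear_combination this
      have hm' : m = (∑ k, f k • v k) + (-g) • w := by
        funext j
        have hj := j.2
        have a := Pc_cols x y t c (colv m) hm hc (j.1 + 1) (by omega) (by omega)
        rw [Vc_congr c hc _ _ hf _ (by omega) (by omega),
          Vc_comb _ (fext f) (Fc x y t n) _ g _ (fun k => rfl), colv_succ] at a
        have b := relation_cols x y t n hn (j.1 + 1) (by omega) (by omega)
        rw [Pi.add_apply, sumv]
        apply mul_left_cancel₀ hG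
        change _ = _ * (_ + (-g) * Wc x t n (j.1 + 1))
        linear_combination -a + g * b
      rw [hm']
      refine Submodule.add_mem _ (Submodule.sum_mem _ fun k _ => Submodule.smul_mem _ _ ?_)
        (Submodule.smul_mem _ _ ?_)
      · exact Submodule.subset_span (Or.inl ⟨k, rfl⟩)
      · exact Submodule.subset_span (Or.inr rfl)
  · intro k
    have hk := k.2
    rw [mem_homogeneousSubmodule, en2]
    exact Fc_hom n _ (by omega)
  · rw [mem_homogeneousSubmodule]
    have h1 := (isHomogeneous_X K (1 : Fin 3)).pow 2
    have h2 := (isHomogeneous_X K (0 : Fin 3)).mul (isHomogeneous_X K (2 : Fin 3))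
    exact h1.add h2
  · rintro ⟨-, h⟩
    exact hG h
  · intro f g hfg
    have hz : ∀ k, k ≤ c + 1 → (y ^ 2 + x * t) * fext f k + (-g) * Fc x y t n k = 0 := by
      apply Vc_inj c hc
      intro j h1 h2
      rw [Vc_comb _ (fext f) (Fc x y t n) (y ^ 2 + x * t) (-g) _ (fun k => rfl)]
      have a := congrFun hfg ⟨j - 1, by omega⟩
      rw [Pi.add_apply, sumv] at a
      have e : j - 1 + 1 = j := by omega
      change Vc x y t (fext f) (j - 1 + 1) + g * Wc x t n (j - 1 + 1) = 0 at a
      rw [e] at a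
      have b := relation_cols x y t n hn j h1 (by omega)
      linear_combination (y ^ 2 + x * t) * a - g * b
    have htop := hz (2 * n) (by omega)
    have eF : Fc x y t n (2 * n) = t ^ n := by
      have e : 2 * n / 2 = n := by omega
      simp only [Fc, e]
      rw [if_pos (by omega), Nat.sub_self, pow_zero, mul_one]
    rw [eF] at htop
    obtain ⟨a, ha⟩ := cancel_t_pow n g ⟨fext f (2 * n), by linear_combination -htop⟩
    refine ⟨a, ?_, by rw [ha]; exact mul_comm _ _⟩
    funext k
    have hk := k.2
    have := hz k.1 (by omega)
    rw [fext, dif_pos hk] at this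
    apply mul_left_cancel₀ hG
    change _ * f ⟨k.1, hk⟩ = _ * (a * Fc x y t n k.1)
    rw [ha] at this
    linear_combination this
end

section
/- Let K be an algebraically closed field of characteristic 0 and let A′ be the explicit 13×23 matrix of linear forms in x, y, t over K defined in the context. Then: (i) rank A′(p) = 13 for every p ∈ K³ \ {0}; and (ii) for every pair of linearly independent vectors w₁, w₂ ∈ K³ and every integer m ≥ 0, the space {v ∈ (K[s,t]_m)^{23} : A′(s·w₁ + t·w₂)·v = 0 in (K[s,t]_{m+1})^{13}} has dimension 2·(m+1) + 4·max(0, m) + 3·max(0, m−1) + max(0, m−2). (This is the claim of Example 16/22: A′ defines a 3-type uniform Steiner bundle of rank 10 on P² with c₁ = −13 and splitting type (−3, −2³, −1⁴, 0²) on every line.) -/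
open Matrix MvPolynomial

/-- (1-based) positions of the entries `x` in the `13 × 23` matrix `A′` of Example 16/22. -/
def xpos : List (ℕ × ℕ) :=
  [(1,1),(2,2),(3,3),(4,4),(5,5),(6,6),(7,11),(8,12),(9,13),(10,17),(11,18),(12,19),(13,22)]

/-- (1-based) positions of the entries `y` in the `13 × 23` matrix `A′` of Example 16/22. -/
def ypos : List (ℕ × ℕ) :=
  [(1,2),(2,4),(3,5),(4,7),(5,8),(6,9),(7,12),(8,14),(9,15),(10,18),(11,20),(12,21),(13,23)]

/-- (1-based) positions of the entries `t` in the `13 × 23` matrix `A′` of Example 16/22. -/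
def tpos : List (ℕ × ℕ) :=
  [(1,3),(2,5),(3,6),(4,8),(5,9),(6,10),(7,13),(8,15),(9,16),(10,19),(11,21),(12,1),(12,14),(13,11),(13,20)]

/-- The explicit `13 × 23` matrix `A′` of Example 16/22, evaluated at
`(x, y, t) = (p 0, p 1, p 2)`. -/
def A'mat {R : Type*} [CommRing R] (p : Fin 3 → R) : Matrix (Fin 13) (Fin 23) R :=
  fun i j =>
    if ((i : ℕ) + 1, (j : ℕ) + 1) ∈ xpos then p 0
    else if ((i : ℕ) + 1, (j : ℕ) + 1) ∈ ypos then p 1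
    else if ((i : ℕ) + 1, (j : ℕ) + 1) ∈ tpos then p 2
    else 0

/-- The restriction `A′(s·w₁ + t·w₂)` of `A′` to the line through `[w₁]` and `[w₂]`,
as a matrix with entries in `K[s,t]` (with `(s, t) = (X 0, X 1)`). -/
noncomputable def A'line {K : Type*} [Field K] (w₁ w₂ : Fin 3 → K) :
    Matrix (Fin 13) (Fin 23) (MvPolynomial (Fin 2) K) :=
  A'mat (fun k =>
    MvPolynomial.C (w₁ k) * MvPolynomial.X 0 + MvPolynomial.C (w₂ k) * MvPolynomial.X 1)


lemma finrank_homog {K : Type*} [Field K] (m : ℕ) :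
    Module.finrank K (homogeneousSubmodule (Fin 2) K m) = m + 1 := by
  rw [homogeneousSubmodule_eq_finsupp_supported]
  have e := (AddMonoidAlgebra.supportedEquivFinsupp (R := K) (S := K) {d : Fin 2 →₀ ℕ | d.degree = m})
  have hset : {d : Fin 2 →₀ ℕ | d.degree = m} = ↑(Finset.finsuppAntidiag (Finset.univ : Finset (Fin 2)) m) := by
    ext d
    simp [Finset.mem_finsuppAntidiag, Finsupp.degree_eq_sum]
  refine (LinearEquiv.finrank_eq e).trans ?_
  rw [hset]
  rw [Module.finrank_finsupp_self]
  simp [Finset.card_finsuppAntidiag_nat_eq_choose]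
  rw [add_comm, Nat.choose_succ_self_right]

lemma homog_decomp {K : Type*} [Field K] (n : ℕ) (f : MvPolynomial (Fin 2) K)
    (hf : f ∈ homogeneousSubmodule (Fin 2) K (n + 1)) :
    ∃ g ∈ homogeneousSubmodule (Fin 2) K n, ∃ h ∈ homogeneousSubmodule (Fin 2) K n,
      f = X 0 * g + X 1 * h := by
  rw [← homogeneousSubmodule_one_pow, pow_succ', homogeneousSubmodule_one_pow] at hf
  induction hf using Submodule.mul_induction_on' with
  | mem_mul_mem a ha b hb =>
    rw [homogeneousSubmodule_one_eq_span_X] at ha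
    have : Set.range (X : Fin 2 → MvPolynomial (Fin 2) K) = {X 0, X 1} := by
      ext x; simp [eq_comm]
    rw [this, Submodule.mem_span_pair] at ha
    obtain ⟨p, q, rfl⟩ := ha
    refine ⟨p • b, Submodule.smul_mem _ _ hb, q • b, Submodule.smul_mem _ _ hb, ?_⟩
    simp only [smul_eq_C_mul]; ring
  | add a _ b _ ha hb =>
    obtain ⟨g, hg, h, hh, rfl⟩ := ha
    obtain ⟨g', hg', h', hh', rfl⟩ := hb
    exact ⟨g + g', add_mem hg hg', h + h', add_mem hh hh', by ring⟩

lemma ses {K A B C : Type*} [Field K] [AddCommGroup A] [AddCommGroup B] [AddCommGroup C]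
    [Module K A] [Module K B] [Module K C] (f : A →ₗ[K] B) (g : B →ₗ[K] C)
    (hf : Function.Injective f) (hg : Function.Surjective g)
    (h1 : ∀ a, g (f a) = 0) (h2 : ∀ b, g b = 0 → ∃ a, f a = b)
    [Module.Finite K A] [Module.Finite K C] :
    Module.Finite K B ∧ Module.finrank K B = Module.finrank K A + Module.finrank K C := by
  have hex : Function.Exact f g := fun b => ⟨h2 b, by rintro ⟨a, rfl⟩; exact h1 a⟩
  have : Module.Finite K B := Module.Finite.of_exact hex hg
  refine ⟨this, ?_⟩
  rw [← LinearMap.finrank_range_add_finrank_ker g, LinearMap.range_eq_top.2 hg, finrank_top,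
    hex.linearMap_ker_eq, LinearMap.finrank_range_of_inj hf, add_comm]

instance finite_homog {K : Type*} [Field K] (m : ℕ) :
    Module.Finite K (homogeneousSubmodule (Fin 2) K m) :=
  Module.Finite.iff_fg.2 (homogeneousSubmodule_fg (Fin 2) K m)

/-- Forms of degree `m - k`, zero when `k > m`. -/
noncomputable def Hs (K : Type*) [Field K] (m k : ℕ) : Submodule K (MvPolynomial (Fin 2) K) :=
  if k ≤ m then homogeneousSubmodule (Fin 2) K (m - k) else ⊥

lemma Hs_zero (K : Type*) [Field K] (m : ℕ) : Hs K m 0 = homogeneousSubmodule (Fin 2) K m := by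
  simp [Hs]

instance Hs_finite (K : Type*) [Field K] (m k : ℕ) : Module.Finite K (Hs K m k) := by
  by_cases h : k ≤ m
  · rw [show Hs K m k = homogeneousSubmodule (Fin 2) K (m - k) from if_pos h]; infer_instance
  · rw [show Hs K m k = ⊥ from if_neg h]; infer_instance

lemma Hs_finrank (K : Type*) [Field K] (m k : ℕ) :
    Module.finrank K (Hs K m k) = m + 1 - k := by
  by_cases h : k ≤ m
  · rw [show Hs K m k = homogeneousSubmodule (Fin 2) K (m - k) from if_pos h, finrank_homog]
    omega
  · rw [show Hs K m k = ⊥ from if_neg h, finrank_bot]; omega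

lemma Hs_mul {K : Type*} [Field K] {m k : ℕ} {l q : MvPolynomial (Fin 2) K}
    (hl : l ∈ homogeneousSubmodule (Fin 2) K 1) (hq : q ∈ Hs K m (k + 1)) : l * q ∈ Hs K m k := by
  unfold Hs at *
  split_ifs at hq with h
  · rw [if_pos (by omega)]
    have := IsHomogeneous.mul hl hq
    rwa [show 1 + (m - (k + 1)) = m - k by omega] at this
  · rw [Submodule.mem_bot] at hq
    simp [hq]

/-- Koszul exactness for two linear forms spanning the linear forms. -/
def Kos {K : Type*} [Field K] (la lb : MvPolynomial (Fin 2) K) : Prop :=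
  ∀ m k f g, f ∈ Hs K m k → g ∈ Hs K m k → la * f + lb * g = 0 →
    ∃ q ∈ Hs K m (k + 1), f = lb * q ∧ g = - (la * q)

lemma kos_aux {K : Type*} [Field K] {la lb : MvPolynomial (Fin 2) K}
    (hla : la ∈ homogeneousSubmodule (Fin 2) K 1) (hlb : lb ∈ homogeneousSubmodule (Fin 2) K 1)
    (p q r s : K) (h0 : X 0 = C p * la + C q * lb) (h1 : X 1 = C r * la + C s * lb)
    (hb0 : lb ≠ 0) : Kos la lb := by
  intro m k f g hf hg hfg
  unfold Hs at hf hg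
  split_ifs at hf hg with hk
  swap
  · rw [Submodule.mem_bot] at hf hg
    exact ⟨0, zero_mem _, by simp [hf], by simp [hg]⟩
  obtain ⟨n, rfl⟩ : ∃ n, m = k + n := ⟨m - k, by omega⟩
  rw [show k + n - k = n by omega] at hf hg
  let H := homogeneousSubmodule (Fin 2) K
  have hmulmem : ∀ {l : MvPolynomial (Fin 2) K} (_ : l ∈ H 1) (n : ℕ) (x : MvPolynomial (Fin 2) K),
      x ∈ H n → l * x ∈ H (n + 1) := by
    intro l hl n x hx
    have := IsHomogeneous.mul hl hx
    rwa [add_comm] at this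
  let mu : (H n × H n) →ₗ[K] H (n + 1) :=
    { toFun := fun x => ⟨la * x.1.1 + lb * x.2.1,
        add_mem (hmulmem hla _ _ x.1.2) (hmulmem hlb _ _ x.2.2)⟩
      map_add' := by
        intro x y; ext1; simp; ring
      map_smul' := by
        intro c x; ext1; simp }
  have hmu : Function.Surjective mu := by
    rintro ⟨f, hf⟩
    obtain ⟨g, hg, h, hh, rfl⟩ := homog_decomp n f hf
    refine ⟨(⟨p • g + r • h, add_mem (Submodule.smul_mem _ _ hg) (Submodule.smul_mem _ _ hh)⟩,
      ⟨q • g + s • h, add_mem (Submodule.smul_mem _ _ hg) (Submodule.smul_mem _ _ hh)⟩), ?_⟩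
    ext1
    change la * (p • g + r • h) + lb * (q • g + s • h) = _
    simp only [smul_eq_C_mul]
    linear_combination (-g) * h0 - h * h1
  have hdim := LinearMap.finrank_range_add_finrank_ker mu
  rw [LinearMap.range_eq_top.2 hmu, finrank_top, Module.finrank_prod, finrank_homog,
    finrank_homog] at hdim
  have hmem : ((⟨f, hf⟩, ⟨g, hg⟩) : H n × H n) ∈ LinearMap.ker mu := by
    rw [LinearMap.mem_ker]; ext1; exact hfg
  cases n with
  | zero =>
    have : LinearMap.ker mu = ⊥ := Submodule.finrank_eq_zero.1 (by omega)
    rw [this, Submodule.mem_bot, Prod.mk_eq_zero] at hmem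
    have e1 : f = 0 := congrArg Subtype.val hmem.1
    have e2 : g = 0 := congrArg Subtype.val hmem.2
    exact ⟨0, zero_mem _, by simp [e1], by simp [e2]⟩
  | succ n =>
    let ka : H n →ₗ[K] (H (n + 1) × H (n + 1)) :=
      { toFun := fun x => (⟨lb * x.1, hmulmem hlb _ _ x.2⟩,
          ⟨- (la * x.1), neg_mem (hmulmem hla _ _ x.2)⟩)
        map_add' := by
          intro x y; ext1 <;> ext1 <;> simp <;> ring
        map_smul' := by
          intro c x; ext1 <;> ext1 <;> simp }
    have hinj : Function.Injective ka := by
      intro x y hxy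
      have := congrArg (fun z => z.1.1) hxy
      ext1
      exact mul_left_cancel₀ hb0 this
    have hr := LinearMap.finrank_range_of_inj hinj
    rw [finrank_homog] at hr
    have hle : LinearMap.range ka ≤ LinearMap.ker mu := by
      rintro _ ⟨x, rfl⟩
      rw [LinearMap.mem_ker]; ext1
      change la * (lb * x.1) + lb * (- (la * x.1)) = 0
      ring
    rw [← Submodule.eq_of_le_of_finrank_eq hle (by omega)] at hmem
    obtain ⟨x, hx⟩ := hmem
    refine ⟨x.1, ?_, (congrArg (fun z => z.1.1) hx).symm, (congrArg (fun z => z.2.1) hx).symm⟩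
    unfold Hs
    rw [if_pos (by omega), show k + (n + 1) - (k + 1) = n by omega]
    exact x.2

/-- Kernel elements, symmetric tensors of order 1, 2, 3 of forms of degree `m`. -/
noncomputable def T1 {K : Type*} [Field K] (l : Fin 3 → MvPolynomial (Fin 2) K) (m : ℕ) :
    Submodule K (Fin 3 → MvPolynomial (Fin 2) K) where
  carrier := {v | (∀ i, v i ∈ Hs K m 0) ∧ ∑ i, l i * v i = 0}
  zero_mem' := by simp
  add_mem' := by
    rintro v w ⟨h1, h2⟩ ⟨h1', h2'⟩
    refine ⟨fun i => add_mem (h1 i) (h1' i), ?_⟩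
    simp [mul_add, Finset.sum_add_distrib, h2, h2']
  smul_mem' := by
    rintro c v ⟨h1, h2⟩
    refine ⟨fun i => Submodule.smul_mem _ _ (h1 i), ?_⟩
    simp [← Finset.smul_sum, h2]

noncomputable def T2 {K : Type*} [Field K] (l : Fin 3 → MvPolynomial (Fin 2) K) (m : ℕ) :
    Submodule K (Fin 3 → Fin 3 → MvPolynomial (Fin 2) K) where
  carrier := {v | (∀ i, v i ∈ T1 l m) ∧ (∀ i j, v i j = v j i)}
  zero_mem' := by
    refine ⟨fun i => zero_mem _, by simp⟩
  add_mem' := by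
    rintro v w ⟨h1, h2⟩ ⟨h1', h2'⟩
    refine ⟨fun i => add_mem (h1 i) (h1' i), ?_⟩
    intro i j
    simp only [Pi.add_apply, h2 i j, h2' i j]
  smul_mem' := by
    rintro c v ⟨h1, h2⟩
    refine ⟨fun i => Submodule.smul_mem _ _ (h1 i), ?_⟩
    intro i j
    simp only [Pi.smul_apply, h2 i j]

noncomputable def T3 {K : Type*} [Field K] (l : Fin 3 → MvPolynomial (Fin 2) K) (m : ℕ) :
    Submodule K (Fin 3 → Fin 3 → Fin 3 → MvPolynomial (Fin 2) K) where
  carrier := {v | (∀ i, v i ∈ T2 l m) ∧ (∀ i j, v i j = v j i)}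
  zero_mem' := by
    refine ⟨fun i => zero_mem _, by simp⟩
  add_mem' := by
    rintro v w ⟨h1, h2⟩ ⟨h1', h2'⟩
    refine ⟨fun i => add_mem (h1 i) (h1' i), ?_⟩
    intro i j
    simp only [Pi.add_apply, h2 i j, h2' i j]
  smul_mem' := by
    rintro c v ⟨h1, h2⟩
    refine ⟨fun i => Submodule.smul_mem _ _ (h1 i), ?_⟩
    intro i j
    simp only [Pi.smul_apply, h2 i j]

structure LineData {K : Type*} [Field K] (l : Fin 3 → MvPolynomial (Fin 2) K) (z : Fin 3 → K)
    (o a b : Fin 3) : Prop where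
  hl : ∀ i, l i ∈ homogeneousSubmodule (Fin 2) K 1
  hz : z o = 1
  hs : ∑ i, l i * C (z i) = 0
  hsum : ∀ f : Fin 3 → MvPolynomial (Fin 2) K, ∑ i, f i = f o + f a + f b
  cov : ∀ i, i = o ∨ i = a ∨ i = b
  hoa : o ≠ a
  hob : o ≠ b
  hab : a ≠ b
  kos : Kos (l a) (l b)
  hb0 : l b ≠ 0

section
variable {K : Type*} [Field K] {l : Fin 3 → MvPolynomial (Fin 2) K} {z : Fin 3 → K}
    {o a b : Fin 3}

/-- the kernel vector of degree one -/
noncomputable def eta (l : Fin 3 → MvPolynomial (Fin 2) K) (a b : Fin 3) (i : Fin 3) :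
    MvPolynomial (Fin 2) K := if i = a then l b else if i = b then - l a else 0

lemma LineData.eta_o (D : LineData l z o a b) : eta l a b o = 0 := by
  simp [eta, D.hoa, D.hob]
lemma LineData.eta_a (_D : LineData l z o a b) : eta l a b a = l b := by
  simp [eta]
lemma LineData.eta_b (D : LineData l z o a b) : eta l a b b = - l a := by
  simp [eta, D.hab.symm]
lemma LineData.eta_mem (D : LineData l z o a b) (i : Fin 3) :
    eta l a b i ∈ homogeneousSubmodule (Fin 2) K 1 := by
  unfold eta
  split_ifs
  · exact D.hl b
  · exact neg_mem (D.hl a)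
  · exact zero_mem _
lemma LineData.eta_sum (D : LineData l z o a b) (q : MvPolynomial (Fin 2) K) :
    ∑ i, l i * (eta l a b i * q) = 0 := by
  rw [D.hsum, D.eta_o, D.eta_a, D.eta_b]; ring
lemma LineData.z_sum (D : LineData l z o a b) (q : MvPolynomial (Fin 2) K) :
    ∑ i, l i * (C (z i) * q) = 0 := by
  have := congrArg (· * q) D.hs
  simpa [Finset.sum_mul, mul_assoc] using this

lemma Hs_C_mul {m k : ℕ} (c : K) {q : MvPolynomial (Fin 2) K} (hq : q ∈ Hs K m k) :
    C c * q ∈ Hs K m k := by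
  rw [← smul_eq_C_mul]; exact Submodule.smul_mem _ _ hq

lemma T1_eta (D : LineData l z o a b) {m : ℕ} {q : MvPolynomial (Fin 2) K} (hq : q ∈ Hs K m 1) :
    (fun i => eta l a b i * q) ∈ T1 l m :=
  ⟨fun i => Hs_mul (D.eta_mem i) hq, D.eta_sum q⟩

lemma T1_z (D : LineData l z o a b) {m : ℕ} {q : MvPolynomial (Fin 2) K} (hq : q ∈ Hs K m 0) :
    (fun i => C (z i) * q) ∈ T1 l m :=
  ⟨fun _ => Hs_C_mul _ hq, D.z_sum q⟩

lemma T1_finrank (D : LineData l z o a b) (m : ℕ) :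
    Module.Finite K (T1 l m) ∧ Module.finrank K (T1 l m) = m + (m + 1) := by
  let f : Hs K m 1 →ₗ[K] T1 l m :=
    { toFun := fun q => ⟨fun i => eta l a b i * q.1, T1_eta D q.2⟩
      map_add' := by intro x y; ext1; funext i; simp [mul_add]
      map_smul' := by intro c x; ext1; funext i; simp }
  let g : T1 l m →ₗ[K] Hs K m 0 :=
    { toFun := fun v => ⟨v.1 o, v.2.1 o⟩
      map_add' := by intro x y; rfl
      map_smul' := by intro c x; rfl }
  have := ses f g ?_ ?_ ?_ ?_
  · rw [Hs_finrank, Hs_finrank] at this; simpa using this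
  · intro x y h
    have h := congrFun (congrArg Subtype.val h) a
    change eta l a b a * x.1 = eta l a b a * y.1 at h
    rw [D.eta_a] at h
    ext1; exact mul_left_cancel₀ D.hb0 h
  · intro u
    refine ⟨⟨fun i => C (z i) * u.1, T1_z D u.2⟩, ?_⟩
    ext1
    change C (z o) * u.1 = u.1
    simp [D.hz]
  · intro q; ext1
    change eta l a b o * q.1 = 0
    simp [D.eta_o]
  · rintro ⟨v, hv1, hv2⟩ h
    have ho : v o = 0 := congrArg Subtype.val h
    rw [D.hsum, ho] at hv2
    obtain ⟨q, hq, e1, e2⟩ := D.kos m 0 (v a) (v b) (hv1 a) (hv1 b) (by linear_combination hv2)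
    refine ⟨⟨q, hq⟩, ?_⟩
    ext1; funext i
    change eta l a b i * q = v i
    rcases D.cov i with rfl | rfl | rfl
    · rw [D.eta_o, ho, zero_mul]
    · rw [D.eta_a, e1]
    · rw [D.eta_b, e2]; ring

lemma T2_eta (D : LineData l z o a b) {m : ℕ} {q : MvPolynomial (Fin 2) K} (hq : q ∈ Hs K m 2) :
    (fun i j => eta l a b i * (eta l a b j * q)) ∈ T2 l m := by
  refine ⟨fun i => ?_, fun i j => by ring⟩
  have := T1_eta D (Hs_mul (D.eta_mem i) hq)
  convert this using 2
  ring

lemma T2_finrank (D : LineData l z o a b) (m : ℕ) :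
    Module.Finite K (T2 l m) ∧ Module.finrank K (T2 l m) = (m - 1) + (m + (m + 1)) := by
  let f : Hs K m 2 →ₗ[K] T2 l m :=
    { toFun := fun q => ⟨fun i j => eta l a b i * (eta l a b j * q.1), T2_eta D q.2⟩
      map_add' := by intro x y; ext1; funext i j; simp [mul_add]
      map_smul' := by intro c x; ext1; funext i j; simp }
  let g : T2 l m →ₗ[K] T1 l m :=
    { toFun := fun v => ⟨v.1 o, v.2.1 o⟩
      map_add' := by intro x y; rfl
      map_smul' := by intro c x; rfl }
  have := (T1_finrank D m).1
  have := ses f g ?_ ?_ ?_ ?_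
  · rw [Hs_finrank, (T1_finrank D m).2] at this; simpa using this
  · intro x y h
    have h := congrFun (congrFun (congrArg Subtype.val h) a) a
    change eta l a b a * (eta l a b a * x.1) = eta l a b a * (eta l a b a * y.1) at h
    rw [D.eta_a] at h
    ext1; exact mul_left_cancel₀ D.hb0 (mul_left_cancel₀ D.hb0 h)
  · rintro ⟨u, hu⟩
    refine ⟨⟨fun i j => C (z i) * u j + C (z j) * u i - C (z j) * (C (z i) * u o),
      fun i => ?_, fun i j => by ring⟩, ?_⟩
    · have e := sub_mem (add_mem ((T1 l m).smul_mem (z i) hu) (T1_z D (hu.1 i)))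
        (T1_z D (Hs_C_mul (z i) (hu.1 o)))
      convert e using 1
      funext j
      simp [smul_eq_C_mul]
    · ext1; funext j
      change C (z o) * u j + C (z j) * u o - C (z j) * (C (z o) * u o) = u j
      rw [D.hz, C_1]; ring
  · intro q; ext1; funext j
    change eta l a b o * (eta l a b j * q.1) = 0
    simp [D.eta_o]
  · rintro ⟨v, hv, hs⟩ h
    have ho : ∀ j, v o j = 0 := congrFun (congrArg Subtype.val h)
    have ho' : ∀ j, v j o = 0 := fun j => by rw [hs, ho]
    have ea := (hv a).2
    have eb := (hv b).2
    rw [D.hsum, ho'] at ea eb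
    obtain ⟨p, hp, e1, e2⟩ := D.kos m 0 (v a a) (v a b) ((hv a).1 a) ((hv a).1 b)
      (by linear_combination ea)
    obtain ⟨p', hp', e3, e4⟩ := D.kos m 0 (v b a) (v b b) ((hv b).1 a) ((hv b).1 b)
      (by linear_combination eb)
    obtain ⟨q, hq, e5, e6⟩ := D.kos m 1 p p' hp hp' (by linear_combination hs b a - e3 + e2)
    refine ⟨⟨q, hq⟩, ?_⟩
    ext1; funext i j
    change eta l a b i * (eta l a b j * q) = v i j
    subst e5 e6
    rcases D.cov i with rfl | rfl | rfl <;> rcases D.cov j with rfl | rfl | rfl <;>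
      simp only [D.eta_o, D.eta_a, D.eta_b, ho, ho', e1, e2, e3, e4] <;> ring

lemma T3_eta (D : LineData l z o a b) {m : ℕ} {q : MvPolynomial (Fin 2) K} (hq : q ∈ Hs K m 3) :
    (fun i j k => eta l a b i * (eta l a b j * (eta l a b k * q))) ∈ T3 l m := by
  refine ⟨fun i => ?_, fun i j => by funext k; ring⟩
  have := T2_eta D (Hs_mul (D.eta_mem i) hq)
  convert this using 3
  ring

lemma T2_zz (D : LineData l z o a b) {m : ℕ} {q : MvPolynomial (Fin 2) K} (hq : q ∈ Hs K m 0) :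
    (fun i j => C (z i) * (C (z j) * q)) ∈ T2 l m := by
  refine ⟨fun i => ?_, fun i j => by ring⟩
  have := T1_z D (Hs_C_mul (z i) hq)
  convert this using 2
  ring

lemma T3_zzz (D : LineData l z o a b) {m : ℕ} {q : MvPolynomial (Fin 2) K} (hq : q ∈ Hs K m 0) :
    (fun i j k => C (z i) * (C (z j) * (C (z k) * q))) ∈ T3 l m := by
  refine ⟨fun i => ?_, fun i j => by funext k; ring⟩
  have := T2_zz D (Hs_C_mul (z i) hq)
  convert this using 3
  ring

/-- symmetrised product of `z` with an element of `T1` -/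
lemma T2_zu (D : LineData l z o a b) {m : ℕ} {u : Fin 3 → MvPolynomial (Fin 2) K}
    (hu : u ∈ T1 l m) : (fun i j => C (z i) * u j + C (z j) * u i) ∈ T2 l m := by
  refine ⟨fun i => ?_, fun i j => by ring⟩
  have e := add_mem ((T1 l m).smul_mem (z i) hu) (T1_z D (hu.1 i))
  convert e using 1
  funext j
  simp [smul_eq_C_mul]

lemma T3_finrank (D : LineData l z o a b) (m : ℕ) :
    Module.Finite K (T3 l m) ∧
      Module.finrank K (T3 l m) = (m - 2) + ((m - 1) + (m + (m + 1))) := by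
  let f : Hs K m 3 →ₗ[K] T3 l m :=
    { toFun := fun q => ⟨fun i j k => eta l a b i * (eta l a b j * (eta l a b k * q.1)),
        T3_eta D q.2⟩
      map_add' := by intro x y; ext1; funext i j k; simp [mul_add]
      map_smul' := by intro c x; ext1; funext i j k; simp }
  let g : T3 l m →ₗ[K] T2 l m :=
    { toFun := fun v => ⟨v.1 o, v.2.1 o⟩
      map_add' := by intro x y; rfl
      map_smul' := by intro c x; rfl }
  have := (T2_finrank D m).1
  have := ses f g ?_ ?_ ?_ ?_
  · rw [Hs_finrank, (T2_finrank D m).2] at this; simpa using this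
  · intro x y h
    have h := congrFun (congrFun (congrFun (congrArg Subtype.val h) a) a) a
    change eta l a b a * (eta l a b a * (eta l a b a * x.1)) =
      eta l a b a * (eta l a b a * (eta l a b a * y.1)) at h
    rw [D.eta_a] at h
    ext1
    exact mul_left_cancel₀ D.hb0 (mul_left_cancel₀ D.hb0 (mul_left_cancel₀ D.hb0 h))
  · rintro ⟨u, hu⟩
    refine ⟨⟨fun i j k => C (z i) * u j k + (C (z j) * u i k + C (z k) * u i j)
        - C (z i) * (C (z j) * u o k + C (z k) * u o j)
        - C (z j) * (C (z k) * u o i) + C (z j) * (C (z k) * (C (z i) * u o o)),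
      fun i => ?_, fun i j => by funext k; have := hu.2 i j; beta_reduce; rw [this]; ring⟩, ?_⟩
    · have e := add_mem (sub_mem (sub_mem (add_mem ((T2 l m).smul_mem (z i) hu)
          (T2_zu D (hu.1 i))) ((T2 l m).smul_mem (z i) (T2_zu D (hu.1 o))))
          (T2_zz D ((hu.1 o).1 i))) (T2_zz D (Hs_C_mul (z i) ((hu.1 o).1 o)))
      convert e using 1
      funext j k
      simp [smul_eq_C_mul, mul_add]
    · ext1; funext j k
      change C (z o) * u j k + (C (z j) * u o k + C (z k) * u o j)
        - C (z o) * (C (z j) * u o k + C (z k) * u o j)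
        - C (z j) * (C (z k) * u o o) + C (z j) * (C (z k) * (C (z o) * u o o)) = u j k
      rw [D.hz, C_1]; ring
  · intro q; ext1; funext j k
    change eta l a b o * (eta l a b j * (eta l a b k * q.1)) = 0
    simp [D.eta_o]
  · rintro ⟨v, hv, hs⟩ h
    have ho : ∀ j k, v o j k = 0 := fun j k =>
      congrFun (congrFun (congrArg Subtype.val h) j) k
    have ho' : ∀ j k, v j o k = 0 := fun j k => by rw [hs, ho]
    have ho'' : ∀ j k, v j k o = 0 := fun j k => by rw [(hv j).2, ho']
    have eaa := ((hv a).1 a).2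
    have eab := ((hv a).1 b).2
    have ebb := ((hv b).1 b).2
    rw [D.hsum, ho''] at eaa eab ebb
    have hm : ∀ i j k, v i j k ∈ Hs K m 0 := fun i j k => ((hv i).1 j).1 k
    obtain ⟨p, hp, e1, e2⟩ := D.kos m 0 (v a a a) (v a a b) (hm _ _ _) (hm _ _ _)
      (by linear_combination eaa)
    obtain ⟨p', hp', e3, e4⟩ := D.kos m 0 (v a b a) (v a b b) (hm _ _ _) (hm _ _ _)
      (by linear_combination eab)
    obtain ⟨p'', hp'', e5, e6⟩ := D.kos m 0 (v b b a) (v b b b) (hm _ _ _) (hm _ _ _)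
      (by linear_combination ebb)
    have s1 : v a a b = v a b a := (hv a).2 a b
    have s2 : v b a b = v a b b := congrFun (hs b a) b
    have s3 : v b a b = v b b a := (hv b).2 a b
    have s4 : v b a a = v a b a := congrFun (hs b a) a
    obtain ⟨r, hr, e7, e8⟩ := D.kos m 1 p p' hp hp' (by linear_combination - s1 - e3 + e2)
    obtain ⟨r', hr', e9, e10⟩ := D.kos m 1 p' p'' hp' hp''
      (by linear_combination s2 - s3 - e5 + e4)
    obtain ⟨q, hq, e11, e12⟩ := D.kos m 2 r r' hr hr' (by linear_combination e8 - e9)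
    refine ⟨⟨q, hq⟩, ?_⟩
    ext1; funext i j k
    change eta l a b i * (eta l a b j * (eta l a b k * q)) = v i j k
    rw [e10, e12] at e6
    rw [e10, e12] at e5
    rw [e8, e11] at e3 e4
    rw [e7, e11] at e1 e2
    rcases D.cov i with rfl | rfl | rfl <;> rcases D.cov j with rfl | rfl | rfl <;>
      rcases D.cov k with rfl | rfl | rfl <;>
      simp only [D.eta_o, D.eta_a, D.eta_b, ho, ho', ho'', s4, s3, e1, e2, e3, e4, e5, e6] <;> ring

end

section
variable {K : Type*} [Field K]

lemma exists_lineData_aux (w₁ w₂ : Fin 3 → K) (o a b : Fin 3)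
    (hsum : ∀ f : Fin 3 → MvPolynomial (Fin 2) K, ∑ i, f i = f o + f a + f b)
    (cov : ∀ i, i = o ∨ i = a ∨ i = b) (hoa : o ≠ a) (hob : o ≠ b) (hab : a ≠ b)
    (hd : w₁ a * w₂ b - w₁ b * w₂ a ≠ 0) :
    ∃ z, LineData (fun k => (C (w₁ k) * X 0 + C (w₂ k) * X 1 : MvPolynomial (Fin 2) K)) z o a b := by
  set d := w₁ a * w₂ b - w₁ b * w₂ a with hdd
  have he : (C (w₁ a) * C (w₂ b) - C (w₁ b) * C (w₂ a)) * C d⁻¹ =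
      (1 : MvPolynomial (Fin 2) K) := by
    rw [← C_mul, ← C_mul, ← C_sub, ← C_mul, ← hdd, mul_inv_cancel₀ hd, C_1]
  have hl : ∀ i, (C (w₁ i) * X 0 + C (w₂ i) * X 1 : MvPolynomial (Fin 2) K) ∈
      homogeneousSubmodule (Fin 2) K 1 := fun i =>
    add_mem (isHomogeneous_C_mul_X _ _) (isHomogeneous_C_mul_X _ _)
  have h0 : (X 0 : MvPolynomial (Fin 2) K) =
      C (w₂ b * d⁻¹) * (C (w₁ a) * X 0 + C (w₂ a) * X 1) +
      C (- w₂ a * d⁻¹) * (C (w₁ b) * X 0 + C (w₂ b) * X 1) := by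
    simp only [C_mul, C_neg]
    linear_combination (- X 0) * he
  have h1 : (X 1 : MvPolynomial (Fin 2) K) =
      C (- w₁ b * d⁻¹) * (C (w₁ a) * X 0 + C (w₂ a) * X 1) +
      C (w₁ a * d⁻¹) * (C (w₁ b) * X 0 + C (w₂ b) * X 1) := by
    simp only [C_mul, C_neg]
    linear_combination (- X 1) * he
  have hb0 : (C (w₁ b) * X 0 + C (w₂ b) * X 1 : MvPolynomial (Fin 2) K) ≠ 0 := by
    intro h
    have c0 := congrArg (eval ![1, 0]) h
    have c1 := congrArg (eval ![0, 1]) h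
    simp at c0 c1
    apply hd
    rw [hdd, c0, c1]; ring
  refine ⟨fun i => if i = o then 1 else if i = a then (w₁ b * w₂ o - w₁ o * w₂ b) * d⁻¹
    else (w₁ o * w₂ a - w₁ a * w₂ o) * d⁻¹, ?_⟩
  refine ⟨hl, by simp, ?_, hsum, cov, hoa, hob, hab, kos_aux (hl a) (hl b) _ _ _ _ h0 h1 hb0, hb0⟩
  rw [hsum]
  simp only [if_true, hoa.symm, hob.symm, hab.symm, if_false, C_mul, C_sub, C_1]
  linear_combination (- (C (w₁ o) * X 0 + C (w₂ o) * X 1)) * he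

lemma exists_lineData (w₁ w₂ : Fin 3 → K) (h : LinearIndependent K ![w₁, w₂]) :
    ∃ z o a b,
      LineData (fun k => (C (w₁ k) * X 0 + C (w₂ k) * X 1 : MvPolynomial (Fin 2) K)) z o a b := by
  rw [← crossProduct_ne_zero_iff_linearIndependent, cross_apply] at h
  by_cases h0 : w₁ 1 * w₂ 2 - w₁ 2 * w₂ 1 = 0
  · by_cases h1 : w₁ 2 * w₂ 0 - w₁ 0 * w₂ 2 = 0
    · by_cases h2 : w₁ 0 * w₂ 1 - w₁ 1 * w₂ 0 = 0
      · exfalso; apply h; rw [h0, h1, h2]; simp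
      · obtain ⟨z, hz⟩ := exists_lineData_aux w₁ w₂ 2 0 1
          (by intro f; rw [Fin.sum_univ_three]; ring) (by decide) (by decide) (by decide)
          (by decide) h2
        exact ⟨z, _, _, _, hz⟩
    · obtain ⟨z, hz⟩ := exists_lineData_aux w₁ w₂ 1 2 0
        (by intro f; rw [Fin.sum_univ_three]; ring) (by decide) (by decide) (by decide)
        (by decide) h1
      exact ⟨z, _, _, _, hz⟩
  · obtain ⟨z, hz⟩ := exists_lineData_aux w₁ w₂ 0 1 2
      (by intro f; rw [Fin.sum_univ_three]) (by decide) (by decide) (by decide)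
      (by decide) h0
    exact ⟨z, _, _, _, hz⟩

end

/-- The matrix written out. -/
lemma A'mat_eq {R : Type*} [CommRing R] (p : Fin 3 → R) : A'mat p =
    let x := p 0
    let y := p 1
    let t := p 2
    !![x,y,t,0,0,0,0,0,0,0, 0,0,0,0,0,0, 0,0,0,0,0, 0,0;
       0,x,0,y,t,0,0,0,0,0, 0,0,0,0,0,0, 0,0,0,0,0, 0,0;
       0,0,x,0,y,t,0,0,0,0, 0,0,0,0,0,0, 0,0,0,0,0, 0,0;
       0,0,0,x,0,0,y,t,0,0, 0,0,0,0,0,0, 0,0,0,0,0, 0,0;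
       0,0,0,0,x,0,0,y,t,0, 0,0,0,0,0,0, 0,0,0,0,0, 0,0;
       0,0,0,0,0,x,0,0,y,t, 0,0,0,0,0,0, 0,0,0,0,0, 0,0;
       0,0,0,0,0,0,0,0,0,0, x,y,t,0,0,0, 0,0,0,0,0, 0,0;
       0,0,0,0,0,0,0,0,0,0, 0,x,0,y,t,0, 0,0,0,0,0, 0,0;
       0,0,0,0,0,0,0,0,0,0, 0,0,x,0,y,t, 0,0,0,0,0, 0,0;
       0,0,0,0,0,0,0,0,0,0, 0,0,0,0,0,0, x,y,t,0,0, 0,0;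
       0,0,0,0,0,0,0,0,0,0, 0,0,0,0,0,0, 0,x,0,y,t, 0,0;
       t,0,0,0,0,0,0,0,0,0, 0,0,0,t,0,0, 0,0,x,0,y, 0,0;
       0,0,0,0,0,0,0,0,0,0, t,0,0,0,0,0, 0,0,0,t,0, x,y] := by
  ext i j
  fin_cases i <;> fin_cases j <;> rfl

lemma rank_part {K : Type*} [Field K] (p : Fin 3 → K) (hp : p ≠ 0) : (A'mat p).rank = 13 := by
  have hli : LinearIndependent K (A'mat p).row := by
    rw [← Matrix.vecMul_injective_iff]
    refine (injective_iff_map_eq_zero (A'mat p).vecMulLinear).2 ?_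
    intro u hu
    have hc : ∀ j, ∑ i, u i * A'mat p i j = 0 := fun j => congrFun hu j
    rw [A'mat_eq] at hc
    obtain ⟨x, hx⟩ : ∃ x, p 0 = x := ⟨_, rfl⟩
    obtain ⟨y, hy⟩ : ∃ x, p 1 = x := ⟨_, rfl⟩
    obtain ⟨t, ht⟩ : ∃ x, p 2 = x := ⟨_, rfl⟩
    simp only [hx, hy, ht] at hc
    have c0 := hc 0
    have c1 := hc 1
    have c2 := hc 2
    have c3 := hc 3
    have c4 := hc 4
    have c5 := hc 5
    have c6 := hc 6
    have c7 := hc 7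
    have c8 := hc 8
    have c9 := hc 9
    have c10 := hc 10
    have c11 := hc 11
    have c12 := hc 12
    have c13 := hc 13
    have c14 := hc 14
    have c15 := hc 15
    have c16 := hc 16
    have c17 := hc 17
    have c18 := hc 18
    have c19 := hc 19
    have c20 := hc 20
    have c21 := hc 21
    have c22 := hc 22
    clear hc hu
    simp [Fin.sum_univ_succ] at c0 c1 c2 c3 c4 c5 c6 c7 c8 c9 c10 c11 c12 c13 c14 c15 c16 c17 c18 c19 c20 c21 c22
    by_cases hx0 : x = 0
    · by_cases hy0 : y = 0
      · have ht0 : t ≠ 0 := by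
          intro ht0
          apply hp
          funext i
          fin_cases i
          · exact hx.trans hx0
          · exact hy.trans hy0
          · exact ht.trans ht0
        have u9 : u 9 = 0 := by simpa [hx0, hy0, ht0] using c18
        have u10 : u 10 = 0 := by simpa [hx0, hy0, ht0, u9] using c20
        have u11 : u 11 = 0 := by simpa [hx0, hy0, ht0, u9, u10] using c0
        have u12 : u 12 = 0 := by simpa [hx0, hy0, ht0, u9, u10, u11] using c10
        have u0 : u 0 = 0 := by simpa [hx0, hy0, ht0, u9, u10, u11, u12] using c2
        have u1 : u 1 = 0 := by simpa [hx0, hy0, ht0, u9, u10, u11, u12, u0] using c4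
        have u2 : u 2 = 0 := by simpa [hx0, hy0, ht0, u9, u10, u11, u12, u0, u1] using c5
        have u3 : u 3 = 0 := by simpa [hx0, hy0, ht0, u9, u10, u11, u12, u0, u1, u2] using c7
        have u4 : u 4 = 0 := by simpa [hx0, hy0, ht0, u9, u10, u11, u12, u0, u1, u2, u3] using c8
        have u5 : u 5 = 0 := by simpa [hx0, hy0, ht0, u9, u10, u11, u12, u0, u1, u2, u3, u4] using c9
        have u6 : u 6 = 0 := by simpa [hx0, hy0, ht0, u9, u10, u11, u12, u0, u1, u2, u3, u4, u5] using c12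
        have u7 : u 7 = 0 := by simpa [hx0, hy0, ht0, u9, u10, u11, u12, u0, u1, u2, u3, u4, u5, u6] using c14
        have u8 : u 8 = 0 := by simpa [hx0, hy0, ht0, u9, u10, u11, u12, u0, u1, u2, u3, u4, u5, u6, u7] using c15
        funext i; fin_cases i <;> assumption
      · have u12 : u 12 = 0 := by simpa [hx0, hy0] using c22
        have u3 : u 3 = 0 := by simpa [hx0, hy0, u12] using c6
        have u10 : u 10 = 0 := by simpa [hx0, hy0, u12, u3] using c19
        have u9 : u 9 = 0 := by simpa [hx0, hy0, u12, u3, u10] using c17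
        have u11 : u 11 = 0 := by simpa [hx0, hy0, u12, u3, u10, u9] using c20
        have u4 : u 4 = 0 := by simpa [hx0, hy0, u12, u3, u10, u9, u11] using c7
        have u5 : u 5 = 0 := by simpa [hx0, hy0, u12, u3, u10, u9, u11, u4] using c8
        have u1 : u 1 = 0 := by simpa [hx0, hy0, u12, u3, u10, u9, u11, u4, u5] using c3
        have u2 : u 2 = 0 := by simpa [hx0, hy0, u12, u3, u10, u9, u11, u4, u5, u1] using c4
        have u0 : u 0 = 0 := by simpa [hx0, hy0, u12, u3, u10, u9, u11, u4, u5, u1, u2] using c1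
        have u6 : u 6 = 0 := by simpa [hx0, hy0, u12, u3, u10, u9, u11, u4, u5, u1, u2, u0] using c11
        have u7 : u 7 = 0 := by simpa [hx0, hy0, u12, u3, u10, u9, u11, u4, u5, u1, u2, u0, u6] using c13
        have u8 : u 8 = 0 := by simpa [hx0, hy0, u12, u3, u10, u9, u11, u4, u5, u1, u2, u0, u6, u7] using c14
        funext i; fin_cases i <;> assumption
    · have u12 : u 12 = 0 := by simpa [hx0] using c21
      have u9 : u 9 = 0 := by simpa [hx0, u12] using c16
      have u10 : u 10 = 0 := by simpa [hx0, u12, u9] using c17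
      have u11 : u 11 = 0 := by simpa [hx0, u12, u9, u10] using c18
      have u0 : u 0 = 0 := by simpa [hx0, u12, u9, u10, u11] using c0
      have u1 : u 1 = 0 := by simpa [hx0, u12, u9, u10, u11, u0] using c1
      have u2 : u 2 = 0 := by simpa [hx0, u12, u9, u10, u11, u0, u1] using c2
      have u3 : u 3 = 0 := by simpa [hx0, u12, u9, u10, u11, u0, u1, u2] using c3
      have u4 : u 4 = 0 := by simpa [hx0, u12, u9, u10, u11, u0, u1, u2, u3] using c4
      have u5 : u 5 = 0 := by simpa [hx0, u12, u9, u10, u11, u0, u1, u2, u3, u4] using c5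
      have u6 : u 6 = 0 := by simpa [hx0, u12, u9, u10, u11, u0, u1, u2, u3, u4, u5] using c10
      have u7 : u 7 = 0 := by simpa [hx0, u12, u9, u10, u11, u0, u1, u2, u3, u4, u5, u6] using c11
      have u8 : u 8 = 0 := by simpa [hx0, u12, u9, u10, u11, u0, u1, u2, u3, u4, u5, u6, u7] using c12
      funext i; fin_cases i <;> assumption
  have := hli.rank_matrix
  simpa using this

section
variable {K : Type*} [Field K] {l : Fin 3 → MvPolynomial (Fin 2) K} {z : Fin 3 → K}
    {o a b : Fin 3}

/-- The two linear conditions defect. -/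
noncomputable def phi (l : Fin 3 → MvPolynomial (Fin 2) K) (m : ℕ) :
    (T3 l m × T2 l m × T2 l m × T1 l m) →ₗ[K] (Hs K m 0 × Hs K m 0) where
  toFun := fun x =>
    (⟨x.2.2.1.1 2 2 - x.1.1 0 0 0 - x.2.1.1 1 1,
        sub_mem (sub_mem ((x.2.2.1.2.1 2).1 2) (((x.1.2.1 0).1 0).1 0)) ((x.2.1.2.1 1).1 1)⟩,
      ⟨x.2.2.2.1 2 - x.2.1.1 0 0 - x.2.2.1.1 1 1,
        sub_mem (sub_mem (x.2.2.2.2.1 2) ((x.2.1.2.1 0).1 0)) ((x.2.2.1.2.1 1).1 1)⟩)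
  map_add' := by
    intro x y; ext1 <;> ext1 <;> simp <;> ring
  map_smul' := by
    intro c x; ext1 <;> ext1 <;> simp [smul_sub]

lemma phi_surj (D : LineData l z o a b) (m : ℕ) : Function.Surjective (phi l m) := by
  rintro ⟨⟨f, hf⟩, ⟨g, hg⟩⟩
  suffices h : ∃ α ∈ Hs K m 0, ∃ β ∈ Hs K m 0, ∃ γ ∈ Hs K m 0, ∃ δ ∈ Hs K m 0,
      C (z 2) * (C (z 2) * γ) - C (z 0) * (C (z 0) * (C (z 0) * α)) - C (z 1) * (C (z 1) * β) = f ∧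
      C (z 2) * δ - C (z 0) * (C (z 0) * β) - C (z 1) * (C (z 1) * γ) = g by
    obtain ⟨α, hα, β, hβ, γ, hγ, δ, hδ, e1, e2⟩ := h
    refine ⟨(⟨_, T3_zzz D hα⟩, ⟨_, T2_zz D hβ⟩, ⟨_, T2_zz D hγ⟩, ⟨_, T1_z D hδ⟩), ?_⟩
    ext1
    · ext1; exact e1
    · ext1; exact e2
  have hinv : ∀ c : K, c ≠ 0 → (C c * C c⁻¹ : MvPolynomial (Fin 2) K) = 1 := by
    intro c hc; rw [← C_mul, mul_inv_cancel₀ hc, C_1]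
  by_cases h2 : z 2 = 0
  · by_cases h0 : z 0 = 0
    · by_cases h1 : z 1 = 0
      · exfalso
        have : ∀ i, z i = 0 := by intro i; fin_cases i <;> assumption
        exact one_ne_zero (D.hz.symm.trans (this o))
      · refine ⟨0, zero_mem _, - (C (z 1)⁻¹ * (C (z 1)⁻¹ * f)),
          neg_mem (Hs_C_mul _ (Hs_C_mul _ hf)), - (C (z 1)⁻¹ * (C (z 1)⁻¹ * g)),
          neg_mem (Hs_C_mul _ (Hs_C_mul _ hg)), 0, zero_mem _, ?_, ?_⟩
        · rw [h2, h0, C_0]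
          linear_combination (f * (C (z 1) * C (z 1)⁻¹) + f) * hinv _ h1
        · rw [h2, h0, C_0]
          linear_combination (g * (C (z 1) * C (z 1)⁻¹) + g) * hinv _ h1
    · set β := - (C (z 0)⁻¹ * (C (z 0)⁻¹ * g)) with hβ
      have hβm : β ∈ Hs K m 0 := neg_mem (Hs_C_mul _ (Hs_C_mul _ hg))
      set F := f + C (z 1) * (C (z 1) * β) with hF
      have hFm : F ∈ Hs K m 0 := add_mem hf (Hs_C_mul _ (Hs_C_mul _ hβm))
      refine ⟨- (C (z 0)⁻¹ * (C (z 0)⁻¹ * (C (z 0)⁻¹ * F))),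
        neg_mem (Hs_C_mul _ (Hs_C_mul _ (Hs_C_mul _ hFm))), β, hβm, 0, zero_mem _, 0, zero_mem _,
        ?_, ?_⟩
      · rw [h2, C_0]
        have e := hinv _ h0
        have e3 : (C (z 0) * C (z 0)⁻¹) ^ 3 = (1 : MvPolynomial (Fin 2) K) := by rw [e]; ring
        linear_combination F * e3 + hF
      · rw [h2, C_0, hβ]
        linear_combination (g * (C (z 0) * C (z 0)⁻¹) + g) * hinv _ h0
  · set γ := C (z 2)⁻¹ * (C (z 2)⁻¹ * f) with hγ
    have hγm : γ ∈ Hs K m 0 := Hs_C_mul _ (Hs_C_mul _ hf)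
    set G := g + C (z 1) * (C (z 1) * γ) with hG
    have hGm : G ∈ Hs K m 0 := add_mem hg (Hs_C_mul _ (Hs_C_mul _ hγm))
    refine ⟨0, zero_mem _, 0, zero_mem _, γ, hγm, C (z 2)⁻¹ * G, Hs_C_mul _ hGm, ?_, ?_⟩
    · rw [hγ]
      linear_combination (f * (C (z 2) * C (z 2)⁻¹) + f) * hinv _ h2
    · linear_combination G * hinv _ h2 + hG

/-- tensors attached to a vector -/
def cub {R : Type*} (v : Fin 23 → R) : Fin 3 → Fin 3 → Fin 3 → R :=
  ![![![v 0, v 1, v 2], ![v 1, v 3, v 4], ![v 2, v 4, v 5]],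
    ![![v 1, v 3, v 4], ![v 3, v 6, v 7], ![v 4, v 7, v 8]],
    ![![v 2, v 4, v 5], ![v 4, v 7, v 8], ![v 5, v 8, v 9]]]

def qua {R : Type*} (v : Fin 23 → R) : Fin 3 → Fin 3 → R :=
  ![![v 10, v 11, v 12], ![v 11, v 13, v 14], ![v 12, v 14, v 15]]

def qub {R : Type*} [Add R] (v : Fin 23 → R) : Fin 3 → Fin 3 → R :=
  ![![v 16, v 17, v 18], ![v 17, v 19, v 20], ![v 18, v 20, v 0 + v 13]]

def lin {R : Type*} [Add R] (v : Fin 23 → R) : Fin 3 → R := ![v 21, v 22, v 10 + v 19]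

lemma cub_add (v w : Fin 23 → MvPolynomial (Fin 2) K) : cub (v + w) = cub v + cub w := by
  funext i j k
  fin_cases i <;> fin_cases j <;> fin_cases k <;> rfl

lemma cub_smul (c : K) (v : Fin 23 → MvPolynomial (Fin 2) K) :
    cub (c • v) = c • cub v := by
  funext i j k
  fin_cases i <;> fin_cases j <;> fin_cases k <;> rfl

lemma qua_add (v w : Fin 23 → MvPolynomial (Fin 2) K) : qua (v + w) = qua v + qua w := by
  funext i j
  fin_cases i <;> fin_cases j <;> rfl

lemma qua_smul (c : K) (v : Fin 23 → MvPolynomial (Fin 2) K) :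
    qua (c • v) = c • qua v := by
  funext i j
  fin_cases i <;> fin_cases j <;> rfl

lemma qub_add (v w : Fin 23 → MvPolynomial (Fin 2) K) : qub (v + w) = qub v + qub w := by
  funext i j
  fin_cases i <;> fin_cases j <;> first | rfl | exact add_add_add_comm _ _ _ _

lemma qub_smul (c : K) (v : Fin 23 → MvPolynomial (Fin 2) K) :
    qub (c • v) = c • qub v := by
  funext i j
  fin_cases i <;> fin_cases j <;> first | rfl | exact (smul_add c (v 0) (v 13)).symm

lemma lin_add (v w : Fin 23 → MvPolynomial (Fin 2) K) : lin (v + w) = lin v + lin w := by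
  funext i
  fin_cases i <;> first | rfl | exact add_add_add_comm _ _ _ _

lemma lin_smul (c : K) (v : Fin 23 → MvPolynomial (Fin 2) K) :
    lin (c • v) = c • lin v := by
  funext i
  fin_cases i <;> first | rfl | exact (smul_add c (v 10) (v 19)).symm

/-- The kernel in the theorem. -/
noncomputable def NN (l : Fin 3 → MvPolynomial (Fin 2) K) (m : ℕ) :
    Submodule K (Fin 23 → MvPolynomial (Fin 2) K) :=
  (Submodule.pi Set.univ (fun _ : Fin 23 => homogeneousSubmodule (Fin 2) K m)) ⊓
          (LinearMap.ker (A'mat l).mulVecLin).restrictScalars K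

lemma mem_T1_vec {m : ℕ} {x y t : MvPolynomial (Fin 2) K} :
    ![x, y, t] ∈ T1 l m ↔ (x ∈ Hs K m 0 ∧ y ∈ Hs K m 0 ∧ t ∈ Hs K m 0) ∧
      l 0 * x + l 1 * y + l 2 * t = 0 := by
  change (∀ i, _) ∧ _ ↔ _
  rw [Fin.sum_univ_three, Fin.forall_fin_succ, Fin.forall_fin_two]
  rfl

lemma mem_T2_vec {m : ℕ} {x y t : Fin 3 → MvPolynomial (Fin 2) K} :
    ![x, y, t] ∈ T2 l m ↔ (x ∈ T1 l m ∧ y ∈ T1 l m ∧ t ∈ T1 l m) ∧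
      (x 1 = y 0 ∧ x 2 = t 0 ∧ y 2 = t 1) := by
  change (∀ i, _) ∧ _ ↔ _
  rw [Fin.forall_fin_succ, Fin.forall_fin_two]
  refine and_congr Iff.rfl ⟨fun h => ⟨h 0 1, h 0 2, h 1 2⟩, ?_⟩
  rintro ⟨h1, h2, h3⟩ i j
  fin_cases i <;> fin_cases j <;> first | rfl | assumption | (symm; assumption)

lemma mem_T3_vec {m : ℕ} {x y t : Fin 3 → Fin 3 → MvPolynomial (Fin 2) K} :
    ![x, y, t] ∈ T3 l m ↔ (x ∈ T2 l m ∧ y ∈ T2 l m ∧ t ∈ T2 l m) ∧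
      (x 1 = y 0 ∧ x 2 = t 0 ∧ y 2 = t 1) := by
  change (∀ i, _) ∧ _ ↔ _
  rw [Fin.forall_fin_succ, Fin.forall_fin_two]
  refine and_congr Iff.rfl ⟨fun h => ⟨h 0 1, h 0 2, h 1 2⟩, ?_⟩
  rintro ⟨h1, h2, h3⟩ i j
  fin_cases i <;> fin_cases j <;> first | rfl | assumption | (symm; assumption)

lemma mem_NN {m : ℕ} (v : Fin 23 → MvPolynomial (Fin 2) K) :
    v ∈ NN l m ↔ (∀ j, v j ∈ Hs K m 0) ∧
      (l 0 * v 0 + l 1 * v 1 + l 2 * v 2 = 0 ∧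
      l 0 * v 1 + l 1 * v 3 + l 2 * v 4 = 0 ∧
      l 0 * v 2 + l 1 * v 4 + l 2 * v 5 = 0 ∧
      l 0 * v 3 + l 1 * v 6 + l 2 * v 7 = 0 ∧
      l 0 * v 4 + l 1 * v 7 + l 2 * v 8 = 0 ∧
      l 0 * v 5 + l 1 * v 8 + l 2 * v 9 = 0 ∧
      l 0 * v 10 + l 1 * v 11 + l 2 * v 12 = 0 ∧
      l 0 * v 11 + l 1 * v 13 + l 2 * v 14 = 0 ∧
      l 0 * v 12 + l 1 * v 14 + l 2 * v 15 = 0 ∧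
      l 0 * v 16 + l 1 * v 17 + l 2 * v 18 = 0 ∧
      l 0 * v 17 + l 1 * v 19 + l 2 * v 20 = 0 ∧
      l 0 * v 18 + l 1 * v 20 + l 2 * (v 0 + v 13) = 0 ∧
      l 0 * v 21 + l 1 * v 22 + l 2 * (v 10 + v 19) = 0) := by
  unfold NN
  rw [Submodule.mem_inf, Submodule.mem_pi, Submodule.restrictScalars_mem, LinearMap.mem_ker,
    Matrix.mulVecLin_apply, A'mat_eq, Hs_zero]
  refine and_congr (by simp) ?_
  rw [funext_iff]
  simp [Fin.forall_fin_succ, Matrix.mulVec, dotProduct, Fin.sum_univ_succ]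
  repeat' apply and_congr
  all_goals (refine Eq.congr ?_ rfl; ring)

lemma T1_eq {m : ℕ} {u : Fin 3 → MvPolynomial (Fin 2) K} (hu : u ∈ T1 l m) :
    l 0 * u 0 + l 1 * u 1 + l 2 * u 2 = 0 := by
  have := hu.2
  rwa [Fin.sum_univ_three] at this

lemma NN_of {m : ℕ} {v : Fin 23 → MvPolynomial (Fin 2) K} (hc : cub v ∈ T3 l m)
    (hq : qua v ∈ T2 l m) (hr : qub v ∈ T2 l m) (hw : lin v ∈ T1 l m) : v ∈ NN l m := by
  rw [mem_NN]
  constructor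
  · intro j
    fin_cases j
    exacts [((hc.1 0).1 0).1 0, ((hc.1 0).1 0).1 1, ((hc.1 0).1 0).1 2,
      ((hc.1 0).1 1).1 1, ((hc.1 0).1 1).1 2, ((hc.1 0).1 2).1 2,
      ((hc.1 1).1 1).1 1, ((hc.1 1).1 1).1 2, ((hc.1 1).1 2).1 2,
      ((hc.1 2).1 2).1 2, (hq.1 0).1 0, (hq.1 0).1 1,
      (hq.1 0).1 2, (hq.1 1).1 1, (hq.1 1).1 2,
      (hq.1 2).1 2, (hr.1 0).1 0, (hr.1 0).1 1,
      (hr.1 0).1 2, (hr.1 1).1 1, (hr.1 1).1 2,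
      hw.1 0, hw.1 1]
  · unfold cub at hc
    unfold qua at hq
    unfold qub at hr
    unfold lin at hw
    obtain ⟨⟨x0, x1, x2⟩, -⟩ := mem_T3_vec.1 hc
    obtain ⟨⟨a0, a1, a2⟩, -⟩ := mem_T2_vec.1 x0
    obtain ⟨⟨-, a3, a4⟩, -⟩ := mem_T2_vec.1 x1
    obtain ⟨⟨-, -, a5⟩, -⟩ := mem_T2_vec.1 x2
    obtain ⟨⟨q0, q1, q2⟩, -⟩ := mem_T2_vec.1 hq
    obtain ⟨⟨r0, r1, r2⟩, -⟩ := mem_T2_vec.1 hr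
    exact ⟨(mem_T1_vec.1 a0).2, (mem_T1_vec.1 a1).2, (mem_T1_vec.1 a2).2,
      (mem_T1_vec.1 a3).2, (mem_T1_vec.1 a4).2, (mem_T1_vec.1 a5).2,
      (mem_T1_vec.1 q0).2, (mem_T1_vec.1 q1).2, (mem_T1_vec.1 q2).2,
      (mem_T1_vec.1 r0).2, (mem_T1_vec.1 r1).2, (mem_T1_vec.1 r2).2,
      (mem_T1_vec.1 hw).2⟩

set_option maxHeartbeats 1000000 in
lemma NN_finrank (D : LineData l z o a b) (m : ℕ) :
    Module.finrank K (NN l m) = 2 * (m + 1) + 4 * m + 3 * (m - 1) + (m - 2) := by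
  let psi : NN l m →ₗ[K] (T3 l m × T2 l m × T2 l m × T1 l m) :=
    { toFun := fun v => (⟨cub v.1, by
          obtain ⟨h, h'⟩ := (mem_NN v.1).1 v.2
          simp [cub, mem_T3_vec, mem_T2_vec, mem_T1_vec, h, h']⟩, ⟨qua v.1, by
          obtain ⟨h, h'⟩ := (mem_NN v.1).1 v.2
          simp [qua, mem_T2_vec, mem_T1_vec, h, h']⟩, ⟨qub v.1, by
          obtain ⟨h, h'⟩ := (mem_NN v.1).1 v.2
          simp [qub, mem_T2_vec, mem_T1_vec, h, h', add_mem]⟩, ⟨lin v.1, by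
          obtain ⟨h, h'⟩ := (mem_NN v.1).1 v.2
          simp [lin, mem_T1_vec, h, h', add_mem]⟩)
      map_add' := fun x y => Prod.ext (Subtype.ext (cub_add _ _)) (Prod.ext
        (Subtype.ext (qua_add _ _)) (Prod.ext (Subtype.ext (qub_add _ _))
        (Subtype.ext (lin_add _ _))))
      map_smul' := fun c x => Prod.ext (Subtype.ext (cub_smul _ _)) (Prod.ext
        (Subtype.ext (qua_smul _ _)) (Prod.ext (Subtype.ext (qub_smul _ _))
        (Subtype.ext (lin_smul _ _)))) }
  have hinj : Function.Injective psi := by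
    intro x y h
    have e1 : cub x.1 = cub y.1 := congrArg (fun w => w.1.1) h
    have e2 : qua x.1 = qua y.1 := congrArg (fun w => w.2.1.1) h
    have e3 : qub x.1 = qub y.1 := congrArg (fun w => w.2.2.1.1) h
    have e4 : lin x.1 = lin y.1 := congrArg (fun w => w.2.2.2.1) h
    have f1 := fun i j k => congrFun (congrFun (congrFun e1 i) j) k
    have f2 := fun i j => congrFun (congrFun e2 i) j
    have f3 := fun i j => congrFun (congrFun e3 i) j
    have f4 := fun i => congrFun e4 i
    ext1
    funext j
    fin_cases j
    exacts [f1 0 0 0, f1 0 0 1, f1 0 0 2, f1 0 1 1, f1 0 1 2, f1 0 2 2, f1 1 1 1, f1 1 1 2,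
      f1 1 2 2, f1 2 2 2, f2 0 0, f2 0 1, f2 0 2, f2 1 1, f2 1 2, f2 2 2, f3 0 0, f3 0 1, f3 0 2,
      f3 1 1, f3 1 2, f4 0, f4 1]
  have i1 := T1_finrank D m
  have i2 := T2_finrank D m
  have i3 := T3_finrank D m
  have j1 := i1.1
  have j2 := i2.1
  have j3 := i3.1
  have : Module.Finite K (NN l m) := Module.Finite.of_injective psi hinj
  have hd := ses psi (phi l m) hinj (phi_surj D m) ?_ ?_
  · have hd := hd.2
    simp only [Module.finrank_prod, Hs_finrank, i1.2, i2.2, i3.2] at hd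
    omega
  · intro v
    ext1
    · ext1
      change (v.1 0 + v.1 13) - v.1 0 - v.1 13 = 0
      ring
    · ext1
      change (v.1 10 + v.1 19) - v.1 10 - v.1 19 = 0
      ring
  · rintro ⟨⟨c, hc⟩, ⟨q, hq⟩, ⟨r, hr⟩, ⟨w, hw⟩⟩ h
    have h1 : r 2 2 - c 0 0 0 - q 1 1 = 0 := congrArg (fun x => x.1.1) h
    have h2 : w 2 - q 0 0 - r 1 1 = 0 := congrArg (fun x => x.2.1) h
    replace h1 : r 2 2 = c 0 0 0 + q 1 1 := by linear_combination h1
    replace h2 : w 2 = q 0 0 + r 1 1 := by linear_combination h2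
    have c1 : ∀ i j k, c i j k = c j i k := fun i j k => congrFun (hc.2 i j) k
    have c2 : ∀ i j k, c i j k = c i k j := fun i j k => (hc.1 i).2 j k
    let v : Fin 23 → MvPolynomial (Fin 2) K :=
      ![c 0 0 0, c 0 0 1, c 0 0 2, c 0 1 1, c 0 1 2, c 0 2 2, c 1 1 1, c 1 1 2, c 1 2 2, c 2 2 2,
        q 0 0, q 0 1, q 0 2, q 1 1, q 1 2, q 2 2, r 0 0, r 0 1, r 0 2, r 1 1, r 1 2, w 0, w 1]
    have ec : cub v = c := by
      funext i j k
      fin_cases i <;> fin_cases j <;> fin_cases k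
      · rfl
      · rfl
      · rfl
      · exact c2 0 0 1
      · rfl
      · rfl
      · exact c2 0 0 2
      · exact c2 0 1 2
      · rfl
      · exact (c2 0 0 1).trans (c1 0 1 0) |>.trans (c2 1 0 0)
      · exact c1 0 1 1
      · exact c1 0 1 2
      · exact (c1 0 1 1).trans (c2 1 0 1)
      · rfl
      · rfl
      · exact (c1 0 1 2).trans (c2 1 0 2)
      · exact c2 1 1 2
      · rfl
      · exact (c2 0 0 2).trans (c1 0 2 0) |>.trans (c2 2 0 0)
      · exact (c2 0 1 2).trans (c1 0 2 1)
      · exact c1 0 2 2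
      · exact ((c2 0 1 2).trans (c1 0 2 1)).trans (c2 2 0 1)
      · exact (c2 1 1 2).trans (c1 1 2 1) |>.trans (c2 2 1 1)
      · exact c1 1 2 2
      · exact (c1 0 2 2).trans (c2 2 0 2)
      · exact (c1 1 2 2).trans (c2 2 1 2)
      · rfl
    have eq : qua v = q := by
      funext i j
      fin_cases i <;> fin_cases j <;> first | rfl | exact hq.2 _ _
    have er : qub v = r := by
      funext i j
      fin_cases i <;> fin_cases j <;> first | rfl | exact h1.symm | exact hr.2 _ _
    have ew : lin v = w := by
      funext i
      fin_cases i <;> first | rfl | exact h2.symm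
    have hv : v ∈ NN l m := by
      exact NN_of (by rw [ec]; exact hc) (by rw [eq]; exact hq) (by rw [er]; exact hr)
        (by rw [ew]; exact hw)
    refine ⟨⟨v, hv⟩, ?_⟩
    refine Prod.ext ?_ (Prod.ext ?_ (Prod.ext ?_ ?_))
    · ext1; exact ec
    · ext1; exact eq
    · ext1; exact er
    · ext1; exact ew

end

/-- **Example 16/22.** The explicit `13 × 23` matrix `A′` defines a 3-type uniform
Steiner bundle of rank 10 on P² with `c₁ = −13` and splitting type `(−3, −2³, −1⁴, 0²)`
on every line: (i) `A′(p)` has rank 13 for every `p ≠ 0`; (ii) for every pair of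
linearly independent `w₁, w₂ ∈ K³` and every `m ≥ 0` the space
`{v ∈ (K[s,t]_m)^{23} : A′(s·w₁ + t·w₂)·v = 0}` has dimension
`2(m+1) + 4·max(0,m) + 3·max(0,m−1) + max(0,m−2)`. -/
theorem stmt17 {K : Type*} [Field K] [IsAlgClosed K] [CharZero K] :
    (∀ p : Fin 3 → K, p ≠ 0 → (A'mat p).rank = 13) ∧
    (∀ w₁ w₂ : Fin 3 → K, LinearIndependent K ![w₁, w₂] → ∀ m : ℕ,
      Module.finrank K
        ↥((Submodule.pi Set.univ
            (fun _ : Fin 23 => homogeneousSubmodule (Fin 2) K m)) ⊓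
          (LinearMap.ker (A'line w₁ w₂).mulVecLin).restrictScalars K) =
        2 * (m + 1) + 4 * m + 3 * (m - 1) + (m - 2)) := by
  refine ⟨fun p hp => rank_part p hp, fun w₁ w₂ h m => ?_⟩
  obtain ⟨z, o, a, b, D⟩ := exists_lineData w₁ w₂ h
  exact NN_finrank D m
end
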